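/- arXiv:1912.06277 — 2 statements merged into one kernel-verified Lean document; each statement's English description precedes it below -/
import Mathlib

section
/- Let ρ_AB be a density operator on H_A ⊗ H_B. Let α > 0 and β, γ ≥ 1/2 with α, β, γ ≠ 1 satisfy α/(α−1) = β/(β−1) + γ/(γ−1) and (α−1)(β−1)(γ−1) > 0. Then I↑_γ(A;B)_ρ ≥ H_β(B)_ρ − H↓_α(B|A)_ρ. -/
open scoped Kronecker ComplexOrder Classical
open Matrix

noncomputable section

/-- Real power taken on the support: `0 ^ r = 0` for every `r`. -/
def supPow (x r : ℝ) : ℝ := if x = 0 then 0 else x ^ r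

variable {n : Type*} [Fintype n] [DecidableEq n]

/-- Power of a Hermitian matrix, taken on its support (junk value `0` otherwise). -/
def matPow (M : Matrix n n ℂ) (r : ℝ) : Matrix n n ℂ :=
  if hM : M.IsHermitian then
    (hM.eigenvectorUnitary : Matrix n n ℂ) *
      (Matrix.diagonal fun i => (supPow (hM.eigenvalues i) r : ℂ)) *
      (star (hM.eigenvectorUnitary : Matrix n n ℂ))
  else 0

/-- A density operator: positive semidefinite with unit trace. -/
def IsDensity (ρ : Matrix n n ℂ) : Prop := ρ.PosSemidef ∧ ρ.trace = 1

/-- `σ` dominates `ρ`: the kernel of `σ` is contained in the kernel of `ρ`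
(equivalently, `supp ρ ⊆ supp σ` for positive semidefinite matrices). -/
def Dominates (σ ρ : Matrix n n ℂ) : Prop := ∀ v, σ.mulVec v = 0 → ρ.mulVec v = 0

/-- The sandwiched Rényi divergence of order `α` (base-2 logarithm), with value `⊤`
when `ρ ⟂ σ`, or when `α > 1` and `supp ρ ⊄ supp σ`. -/
def renyiDiv (α : ℝ) (ρ σ : Matrix n n ℂ) : EReal :=
  if (ρ * σ).trace ≠ 0 ∧ (Dominates σ ρ ∨ α < 1) then
    (((α - 1)⁻¹ * Real.logb 2
      ((matPow (matPow σ ((1 - α) / (2 * α)) * ρ * matPow σ ((1 - α) / (2 * α))) α).trace.re) : ℝ)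
      : EReal)
  else ⊤

/-- The Rényi entropy of order `α` (base-2 logarithm). -/
def renyiEntropy (α : ℝ) (ρ : Matrix n n ℂ) : ℝ :=
  (1 - α)⁻¹ * Real.logb 2 ((matPow ρ α).trace.re)

variable {A B : Type*} [Fintype A] [Fintype B] [DecidableEq A] [DecidableEq B]

/-- Marginal on the first factor: `ρ_A = tr_B ρ_AB`. -/
def margFst (ρ : Matrix (A × B) (A × B) ℂ) : Matrix A A ℂ :=
  Matrix.of fun a a' => ∑ b, ρ (a, b) (a', b)

/-- Marginal on the second factor: `ρ_B = tr_A ρ_AB`. -/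
def margSnd (ρ : Matrix (A × B) (A × B) ℂ) : Matrix B B ℂ :=
  Matrix.of fun b b' => ∑ a, ρ (a, b) (a, b')

/-- `H↓_α(B|A)_ρ = −D_α(ρ_AB ‖ ρ_A ⊗ 1_B)`. -/
def condEntDown (α : ℝ) (ρ : Matrix (A × B) (A × B) ℂ) : EReal :=
  - renyiDiv α ρ (margFst ρ ⊗ₖ (1 : Matrix B B ℂ))

/-- `H↑_α(B|A)_ρ = sup_{σ_A} −D_α(ρ_AB ‖ σ_A ⊗ 1_B)`. -/
def condEntUp (α : ℝ) (ρ : Matrix (A × B) (A × B) ℂ) : EReal :=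
  ⨆ σA : {σ : Matrix A A ℂ // IsDensity σ},
    - renyiDiv α ρ ((σA : Matrix A A ℂ) ⊗ₖ (1 : Matrix B B ℂ))

/-- `I↑_γ(A;B)_ρ = inf_{σ_B} D_γ(ρ_AB ‖ ρ_A ⊗ σ_B)`. -/
def mutInfUp (γ : ℝ) (ρ : Matrix (A × B) (A × B) ℂ) : EReal :=
  ⨅ σB : {σ : Matrix B B ℂ // IsDensity σ},
    renyiDiv γ ρ (margFst ρ ⊗ₖ (σB : Matrix B B ℂ))

/-- `I↓_γ(A:B)_ρ = inf_{σ_A, σ_B} D_γ(ρ_AB ‖ σ_A ⊗ σ_B)`. -/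
def mutInfDown (γ : ℝ) (ρ : Matrix (A × B) (A × B) ℂ) : EReal :=
  ⨅ σA : {σ : Matrix A A ℂ // IsDensity σ}, ⨅ σB : {σ : Matrix B B ℂ // IsDensity σ},
    renyiDiv γ ρ ((σA : Matrix A A ℂ) ⊗ₖ (σB : Matrix B B ℂ))

end

open Real in
/-- Hölder's inequality for finite sums, in logarithmic form. -/
theorem log_sum_le_of_le_rpow_mul_rpow {ι : Type*} [Fintype ι] {x y z : ι → ℝ} {s t : ℝ}
    (hs : 0 < s) (ht : 0 < t) (hst : s + t = 1) (hx : ∀ i, 0 ≤ x i) (hy : ∀ i, 0 ≤ y i)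
    (hz : ∀ i, z i ≤ x i ^ s * y i ^ t) (hpos : 0 < ∑ i, z i) :
    log (∑ i, z i) ≤ s * log (∑ i, x i) + t * log (∑ i, y i) := by
  have hpq : Real.HolderConjugate s⁻¹ t⁻¹ :=
    ⟨by simp [hst], by positivity, by positivity⟩
  have hle : ∑ i, z i ≤ (∑ i, x i) ^ s * (∑ i, y i) ^ t := by
    refine (Finset.sum_le_sum fun i _ => hz i).trans ?_
    have h := Real.inner_le_Lp_mul_Lq_of_nonneg Finset.univ hpq
      (fun i _ => rpow_nonneg (hx i) s) (fun i _ => rpow_nonneg (hy i) t)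
    simpa [← rpow_mul, hx, hy, hs.ne', ht.ne'] using h
  have hX : 0 ≤ ∑ i, x i := Finset.sum_nonneg fun i _ => hx i
  have hY : 0 ≤ ∑ i, y i := Finset.sum_nonneg fun i _ => hy i
  have hprod := hpos.trans_le hle
  have hX' : 0 < ∑ i, x i := hX.lt_of_ne' fun h => by
    rw [h, zero_rpow hs.ne', zero_mul] at hprod; exact hprod.false
  have hY' : 0 < ∑ i, y i := hY.lt_of_ne' fun h => by
    rw [h, zero_rpow ht.ne', mul_zero] at hprod; exact hprod.false
  rw [← log_rpow hX', ← log_rpow hY', ← log_mul (rpow_pos_of_pos hX' _).ne'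
    (rpow_pos_of_pos hY' _).ne']
  exact log_le_log hpos hle

theorem sum_pos_of_pos {ι : Type*} [Fintype ι] {x : ι → ℝ} (hx : ∀ i, 0 ≤ x i) {i : ι}
    (hi : 0 < x i) : 0 < ∑ i, x i :=
  Finset.sum_pos' (fun i _ => hx i) ⟨i, Finset.mem_univ i, hi⟩

open Real in
/-- One half of the variational formula for the logarithm of the `p`-norm, valid on both sides
of `p = 1`. -/
theorem mul_log_sum_mul_rpow_le {ι : Type*} [Fintype ι] {g t : ι → ℝ} {p : ℝ}
    (hp : 0 < p) (hp1 : p ≠ 1) (hg : ∀ i, 0 ≤ g i) (ht : ∀ i, 0 ≤ t i) (ht1 : ∑ i, t i = 1)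
    (hsupp : p < 1 → ∀ i, t i = 0 → g i = 0) {i₀ : ι} (hg₀ : 0 < g i₀) (ht₀ : 0 < t i₀) :
    p / (p - 1) * log (∑ i, g i * t i ^ ((p - 1) / p)) ≤ (p - 1)⁻¹ * log (∑ i, g i ^ p) := by
  rcases hp1.lt_or_gt with h1 | h1
  · have h := log_sum_le_of_le_rpow_mul_rpow (x := fun i => g i * t i ^ ((p - 1) / p)) (y := t)
      (z := fun i => g i ^ p) hp (sub_pos.2 h1) (by ring)
      (fun i => mul_nonneg (hg i) (rpow_nonneg (ht i) _)) ht (fun i => by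
        rcases (ht i).eq_or_lt with h0 | h0
        · rw [hsupp h1 i h0.symm, zero_rpow hp.ne', zero_mul, zero_rpow hp.ne', zero_mul]
        · rw [mul_rpow (hg i) (rpow_nonneg (ht i) _), ← rpow_mul (ht i), mul_assoc,
            ← rpow_add h0]
          have : (p - 1) / p * p + (1 - p) = 0 := by field_simp; ring
          simp [this])
      (sum_pos_of_pos (fun i => rpow_nonneg (hg i) _) (rpow_pos_of_pos hg₀ p))
    rw [ht1, log_one, mul_zero, add_zero] at h
    have hneg : (p - 1)⁻¹ ≤ 0 := inv_nonpos.2 (by linarith)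
    have := mul_le_mul_of_nonpos_left h hneg
    rw [div_eq_inv_mul, mul_assoc]
    exact this
  · have h1' : 0 < p - 1 := by linarith
    have h := log_sum_le_of_le_rpow_mul_rpow (x := fun i => g i ^ p) (y := t)
      (z := fun i => g i * t i ^ ((p - 1) / p)) (inv_pos.2 hp) (div_pos h1' hp)
      (by field_simp; ring) (fun i => rpow_nonneg (hg i) _) ht
      (fun i => by rw [← rpow_mul (hg i), mul_inv_cancel₀ hp.ne', rpow_one])
      (sum_pos_of_pos (fun i => mul_nonneg (hg i) (rpow_nonneg (ht i) _))
        (mul_pos hg₀ (rpow_pos_of_pos ht₀ _)))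
    rw [ht1, log_one, mul_zero, add_zero] at h
    have := mul_le_mul_of_nonneg_left h (div_pos hp h1').le
    refine this.trans_eq ?_
    field_simp

open Real in
/-- Three-point Hölder inequality: if `F ^ (1/a)` is the product of `U ^ (1/c)` and `V ^ (1/b)`
on the support of the weight `m`, then the corresponding logarithmic means satisfy an inequality
whose direction does not depend on the signs of the exponents. -/
theorem inv_mul_log_sum_le {ι : Type*} [Fintype ι] {m l k t : ι → ℝ} {a b c : ℝ}
    (ha : a ≠ 0) (hb : b ≠ 0) (hc : c ≠ 0) (habc : 0 < a * b * c) (hrel : a⁻¹ = b⁻¹ + c⁻¹)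
    (hm : ∀ i, 0 ≤ m i) (hl : ∀ i, 0 ≤ l i) (hk : ∀ i, 0 ≤ k i) (ht : ∀ i, 0 ≤ t i)
    (hml : ∀ i, l i = 0 → m i = 0) (hmt : ∀ i, t i = 0 → m i = 0)
    (hmk : 0 < c → ∀ i, k i = 0 → m i = 0) {i₀ : ι} (hm₀ : 0 < m i₀) (hk₀ : 0 < k i₀) :
    a⁻¹ * log (∑ i, l i ^ (-a) * m i * t i ^ a) ≤
      b⁻¹ * log (∑ i, m i * k i ^ b) + c⁻¹ * log (∑ i, (l i * k i) ^ (-c) * m i * t i ^ c) := by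
  have hl₀ : 0 < l i₀ := (hl _).lt_of_ne' fun h => hm₀.ne' (hml _ h)
  have ht₀ : 0 < t i₀ := (ht _).lt_of_ne' fun h => hm₀.ne' (hmt _ h)
  set F : ι → ℝ := fun i => l i ^ (-a) * m i * t i ^ a with hF
  set V : ι → ℝ := fun i => m i * k i ^ b with hV
  set U : ι → ℝ := fun i => (l i * k i) ^ (-c) * m i * t i ^ c with hU
  have hF0 : ∀ i, 0 ≤ F i := fun i =>
    mul_nonneg (mul_nonneg (rpow_nonneg (hl i) _) (hm i)) (rpow_nonneg (ht i) _)
  have hV0 : ∀ i, 0 ≤ V i := fun i => mul_nonneg (hm i) (rpow_nonneg (hk i) _)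
  have hU0 : ∀ i, 0 ≤ U i := fun i => mul_nonneg (mul_nonneg
    (rpow_nonneg (mul_nonneg (hl i) (hk i)) _) (hm i)) (rpow_nonneg (ht i) _)
  have hFs : 0 < ∑ i, F i := sum_pos_of_pos hF0 (i := i₀) (by positivity)
  have hVs : 0 < ∑ i, V i := sum_pos_of_pos hV0 (i := i₀) (by positivity)
  have hUs : 0 < ∑ i, U i := sum_pos_of_pos hU0 (i := i₀) (by positivity)
  have hzero : ∀ i, m i = 0 → F i = 0 ∧ V i = 0 ∧ U i = 0 := fun i h => by simp [hF, hV, hU, h]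
  have hlog : ∀ i, 0 < m i → 0 < k i →
      (0 < F i ∧ 0 < V i ∧ 0 < U i) ∧ a⁻¹ * log (F i) = b⁻¹ * log (V i) + c⁻¹ * log (U i) := by
    intro i hmi hki
    have hli : 0 < l i := (hl _).lt_of_ne' fun h => hmi.ne' (hml _ h)
    have hti : 0 < t i := (ht _).lt_of_ne' fun h => hmi.ne' (hmt _ h)
    refine ⟨⟨by positivity, by positivity, by positivity⟩, ?_⟩
    simp only [hF, hV, hU]
    rw [log_mul (by positivity) (by positivity), log_mul (by positivity) (by positivity),
      log_mul (by positivity) (by positivity), log_mul (by positivity) (by positivity),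
      log_mul (by positivity) (by positivity), log_rpow hli, log_rpow hti, log_rpow hki,
      log_rpow (by positivity), log_rpow hti, log_mul hli.ne' hki.ne']
    have e : ∀ x y : ℝ, x ≠ 0 → x⁻¹ * (x * y) = y := fun x y hx => inv_mul_cancel_left₀ hx y
    simp only [mul_add, neg_mul, mul_neg, e _ _ ha, e _ _ hb, e _ _ hc]
    rw [hrel]
    ring
  have key : ∀ {x y z : ι → ℝ} {s r : ℝ}, (∀ i, 0 ≤ x i) → (∀ i, 0 ≤ y i) → (∀ i, 0 ≤ z i) →
      0 < s → 0 < r → s + r = 1 → 0 < ∑ i, z i →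
      (∀ i, m i = 0 ∨ k i = 0 → z i = 0) →
      (∀ i, 0 < m i → 0 < k i → 0 < x i ∧ 0 < y i ∧ 0 < z i ∧
        log (z i) = s * log (x i) + r * log (y i)) →
      log (∑ i, z i) ≤ s * log (∑ i, x i) + r * log (∑ i, y i) := by
    intro x y z s r hx hy hz hs hr hsr hpos hz0 h
    refine log_sum_le_of_le_rpow_mul_rpow hs hr hsr hx hy (fun i => ?_) hpos
    rcases (hm i).eq_or_lt with h0 | h0
    · rw [hz0 i (Or.inl h0.symm)]; exact mul_nonneg (rpow_nonneg (hx i) _) (rpow_nonneg (hy i) _)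
    rcases (hk i).eq_or_lt with h1 | h1
    · rw [hz0 i (Or.inr h1.symm)]; exact mul_nonneg (rpow_nonneg (hx i) _) (rpow_nonneg (hy i) _)
    obtain ⟨hxi, hyi, hzi, he⟩ := h i h0 h1
    refine ((log_le_log_iff hzi (by positivity)).1 ?_)
    rw [log_mul (by positivity) (by positivity), log_rpow hxi, log_rpow hyi, he]
  have hsum : a * b⁻¹ + a * c⁻¹ = 1 := by rw [← mul_add, ← hrel, mul_inv_cancel₀ ha]
  rcases hc.lt_or_gt with hc' | hc'
  · have hab : a * b < 0 := by by_contra! h; nlinarith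
    have hic : c⁻¹ < 0 := inv_lt_zero.2 hc'
    have hb' : 0 < b := by
      by_contra! h
      have hib : b⁻¹ ≤ 0 := inv_nonpos.2 h
      have : a⁻¹ < 0 := by linarith
      have : a < 0 := inv_lt_zero.1 this
      nlinarith
    have ha' : a < 0 := by by_contra! h; nlinarith
    have hib : 0 < b⁻¹ := inv_pos.2 hb'
    have hia : a⁻¹ < 0 := inv_lt_zero.2 ha'
    have h := key (x := F) (y := V) (z := U) (s := c * a⁻¹) (r := -(c * b⁻¹)) hF0 hV0 hU0
      (mul_pos_of_neg_of_neg hc' hia) (by nlinarith) (by rw [hrel]; field_simp; ring) hUs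
      (fun i hi => hi.elim (fun h => (hzero i h).2.2)
        (fun h => by simp [hU, h, zero_rpow (neg_ne_zero.2 hc)]))
      (fun i h1 h2 => by
        obtain ⟨⟨p1, p2, p3⟩, e⟩ := hlog i h1 h2
        refine ⟨p1, p2, p3, ?_⟩
        rw [mul_assoc, e]; field_simp; ring)
    have := mul_le_mul_of_nonpos_left h hic.le
    have e1 : c⁻¹ * (c * a⁻¹ * log (∑ i, F i) + -(c * b⁻¹) * log (∑ i, V i)) =
      a⁻¹ * log (∑ i, F i) - b⁻¹ * log (∑ i, V i) := by field_simp; ring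
    linarith
  · have hkm : ∀ i, m i = 0 ∨ k i = 0 → m i = 0 := fun i hi => hi.elim id (hmk hc' i)
    have hic : 0 < c⁻¹ := inv_pos.2 hc'
    have hab : 0 < a * b := by by_contra! h; nlinarith
    rcases ha.lt_or_gt with ha' | ha'
    · have hb' : b < 0 := by by_contra! h; nlinarith
      have hia : a⁻¹ < 0 := inv_lt_zero.2 ha'
      have hib : b⁻¹ < 0 := inv_lt_zero.2 hb'
      have h := key (x := F) (y := U) (z := V) (s := b * a⁻¹) (r := -(b * c⁻¹)) hF0 hU0 hV0
        (mul_pos_of_neg_of_neg hb' hia) (by nlinarith) (by rw [hrel]; field_simp; ring) hVs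
        (fun i hi => (hzero i (hkm i hi)).2.1)
        (fun i h1 h2 => by
          obtain ⟨⟨p1, p2, p3⟩, e⟩ := hlog i h1 h2
          refine ⟨p1, p3, p2, ?_⟩
          rw [mul_assoc, e]; field_simp; ring)
      have := mul_le_mul_of_nonpos_left h hib.le
      have e1 : b⁻¹ * (b * a⁻¹ * log (∑ i, F i) + -(b * c⁻¹) * log (∑ i, U i)) =
        a⁻¹ * log (∑ i, F i) - c⁻¹ * log (∑ i, U i) := by field_simp; ring
      linarith
    · have hb' : 0 < b := by by_contra! h; nlinarith
      have hia : 0 < a⁻¹ := inv_pos.2 ha'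
      have hib : 0 < b⁻¹ := inv_pos.2 hb'
      have h := key (x := V) (y := U) (z := F) (s := a * b⁻¹) (r := a * c⁻¹) hV0 hU0 hF0
        (by positivity) (by positivity) hsum hFs (fun i hi => (hzero i (hkm i hi)).1)
        (fun i h1 h2 => by
          obtain ⟨⟨p1, p2, p3⟩, e⟩ := hlog i h1 h2
          refine ⟨p2, p3, p1, ?_⟩
          rw [mul_assoc, mul_assoc, ← mul_add, ← e, mul_inv_cancel_left₀ ha])
      have := mul_le_mul_of_nonneg_left h hia.le
      have e1 : a⁻¹ * (a * b⁻¹ * log (∑ i, V i) + a * c⁻¹ * log (∑ i, U i)) =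
        b⁻¹ * log (∑ i, V i) + c⁻¹ * log (∑ i, U i) := by field_simp
      linarith

open Real in
/-- The commutative core of the decomposition rule. -/
theorem classical_renyi_decomposition {A B J : Type*} [Fintype A] [Fintype B] [Fintype J]
    {m : A × B → J → ℝ} {l : A → ℝ} {k : B → ℝ} {α β γ : ℝ}
    (hα : 0 < α) (hβ : 0 < β) (hγ : 0 < γ) (hα1 : α ≠ 1) (hβ1 : β ≠ 1) (hγ1 : γ ≠ 1)
    (hrel : α / (α - 1) = β / (β - 1) + γ / (γ - 1))
    (hsign : 0 < (α - 1) * (β - 1) * (γ - 1))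
    (hm : ∀ i j, 0 ≤ m i j) (hl : ∀ a, 0 ≤ l a) (hk : ∀ b, 0 ≤ k b) (hk1 : ∑ b, k b = 1)
    (hml : ∀ i j, l i.1 = 0 → m i j = 0) (hmk : 1 < γ → ∀ i j, k i.2 = 0 → m i j = 0)
    {i₀ : A × B} {j₀ : J} (hm₀ : 0 < m i₀ j₀) (hk₀ : 0 < k i₀.2) :
    (α - 1)⁻¹ * log (∑ j, (∑ i : A × B, l i.1 ^ ((1 - α) / α) * m i j) ^ α) +
        (1 - β)⁻¹ * log (∑ b, (∑ a, ∑ j, m (a, b) j) ^ β) ≤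
      (γ - 1)⁻¹ * log (∑ j, (∑ i : A × B, (l i.1 * k i.2) ^ ((1 - γ) / γ) * m i j) ^ γ) := by
  have hα' := sub_ne_zero.2 hα1
  have hβ' := sub_ne_zero.2 hβ1
  have hγ' := sub_ne_zero.2 hγ1
  set z : J → ℝ := fun j => ∑ i : A × B, l i.1 ^ ((1 - α) / α) * m i j with hz
  set g : J → ℝ := fun j => ∑ i : A × B, (l i.1 * k i.2) ^ ((1 - γ) / γ) * m i j with hg
  set q : B → ℝ := fun b => ∑ a, ∑ j, m (a, b) j with hq
  have hzt : ∀ i j, 0 ≤ l i.1 ^ ((1 - α) / α) * m i j := fun i j =>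
    mul_nonneg (rpow_nonneg (hl _) _) (hm _ _)
  have hgt : ∀ i j, 0 ≤ (l i.1 * k i.2) ^ ((1 - γ) / γ) * m i j := fun i j =>
    mul_nonneg (rpow_nonneg (mul_nonneg (hl _) (hk _)) _) (hm _ _)
  have hz0 : ∀ j, 0 ≤ z j := fun j => Finset.sum_nonneg fun i _ => hzt i j
  have hg0 : ∀ j, 0 ≤ g j := fun j => Finset.sum_nonneg fun i _ => hgt i j
  have hq0 : ∀ b, 0 ≤ q b := fun b =>
    Finset.sum_nonneg fun a _ => Finset.sum_nonneg fun j _ => hm _ _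
  have hl₀ : 0 < l i₀.1 := (hl _).lt_of_ne' fun h => hm₀.ne' (hml _ _ h)
  have hz₀ : 0 < z j₀ := sum_pos_of_pos (fun i => hzt i j₀) (i := i₀) (by positivity)
  have hg₀ : 0 < g j₀ := sum_pos_of_pos (fun i => hgt i j₀) (i := i₀) (by positivity)
  have hq₀ : 0 < q i₀.2 := sum_pos_of_pos (fun a => Finset.sum_nonneg fun j _ => hm _ _)
    (i := i₀.1) (sum_pos_of_pos (fun j => hm _ j) hm₀)
  have hzm : ∀ i j, z j = 0 → m i j = 0 := fun i j h => by
    have := (Finset.sum_eq_zero_iff_of_nonneg fun i _ => hzt i j).1 h i (Finset.mem_univ i)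
    rcases mul_eq_zero.1 this with h1 | h1
    · exact hml i j (((rpow_eq_zero_iff_of_nonneg (hl _)).1 h1).1)
    · exact h1
  set S : ℝ := ∑ j, z j ^ α with hS
  have hS0 : 0 < S := sum_pos_of_pos (fun j => rpow_nonneg (hz0 j) _) (rpow_pos_of_pos hz₀ α)
  set t : J → ℝ := fun j => z j ^ α / S with ht
  have ht0 : ∀ j, 0 ≤ t j := fun j => div_nonneg (rpow_nonneg (hz0 j) _) hS0.le
  have ht1 : ∑ j, t j = 1 := by simp only [ht]; rw [← Finset.sum_div, ← hS, div_self hS0.ne']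
  have ht₀ : 0 < t j₀ := div_pos (rpow_pos_of_pos hz₀ α) hS0
  have htz : ∀ j, t j = 0 → z j = 0 := fun j h => by
    rcases div_eq_zero_iff.1 h with h | h
    · exact ((rpow_eq_zero_iff_of_nonneg (hz0 j)).1 h).1
    · exact absurd h hS0.ne'
  have hγ_of : β < 1 → 1 < γ := fun hb => by
    by_contra! hc
    have h1 : γ < 1 := lt_of_le_of_ne hc hγ1
    have h2 : 1 < α := by by_contra! h; nlinarith [mul_pos (sub_pos.2 hb) (sub_pos.2 h1)]
    have h3 : 0 < α / (α - 1) := div_pos hα (sub_pos.2 h2)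
    have h4 : β / (β - 1) < 0 := div_neg_of_pos_of_neg hβ (by linarith)
    have h5 : γ / (γ - 1) < 0 := div_neg_of_pos_of_neg hγ (by linarith)
    linarith
  have hG := mul_log_sum_mul_rpow_le hγ hγ1 hg0 ht0 ht1 (fun _ j h => by
    simp [hg, hzm _ _ (htz j h)]) hg₀ ht₀
  have hQ := mul_log_sum_mul_rpow_le hβ hβ1 hq0 hk hk1 (fun hb b h => by
    simp [hq, hmk (hγ_of hb) (_, b) _ h]) hq₀ hk₀
  have hH := inv_mul_log_sum_le (ι := (A × B) × J) (m := fun x => m x.1 x.2)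
    (l := fun x => l x.1.1) (k := fun x => k x.1.2) (t := fun x => t x.2)
    (a := (α - 1) / α) (b := (β - 1) / β) (c := (γ - 1) / γ)
    (div_ne_zero hα' hα.ne') (div_ne_zero hβ' hβ.ne') (div_ne_zero hγ' hγ.ne')
    (by
      have : (α - 1) / α * ((β - 1) / β) * ((γ - 1) / γ) =
        ((α - 1) * (β - 1) * (γ - 1)) / (α * β * γ) := by field_simp
      rw [this]; positivity)
    (by simpa using hrel) (fun x => hm _ _) (fun x => hl _) (fun x => hk _) (fun x => ht0 _)
    (fun x h => hml _ _ h) (fun x h => hzm _ _ (htz _ h))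
    (fun hc x h => hmk (by
      by_contra! h'
      exact absurd hc (not_lt.2 (div_nonpos_of_nonpos_of_nonneg (by linarith) hγ.le))) _ _ h)
    (i₀ := (i₀, j₀)) hm₀ hk₀
  have eF : ∑ x : (A × B) × J, l x.1.1 ^ (-((α - 1) / α)) * m x.1 x.2 * t x.2 ^ ((α - 1) / α) =
      S ^ α⁻¹ := by
    rw [Fintype.sum_prod_type_right]
    have : ∀ j, ∑ i : A × B, l i.1 ^ (-((α - 1) / α)) * m i j * t j ^ ((α - 1) / α) =
        z j ^ α * S ^ (-((α - 1) / α)) := fun j => by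
      rw [← Finset.sum_mul, ← neg_div, neg_sub]
      change z j * _ = _
      rcases (hz0 j).eq_or_lt with h | h
      · rw [← h, zero_rpow hα.ne', zero_mul, zero_mul]
      · simp only [ht]
        rw [div_rpow (rpow_nonneg h.le _) hS0.le, ← rpow_mul h.le, div_eq_mul_inv,
          ← rpow_neg hS0.le, ← mul_assoc]
        congr 1
        · rw [mul_comm, ← rpow_add_one h.ne']
          congr 1
          field_simp
          ring
        · congr 1
          ring
    simp only [this]
    rw [← Finset.sum_mul, ← hS]
    conv_lhs => rw [← rpow_one_add' hS0.le (by field_simp; simp [hα.ne'])]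
    congr 1
    field_simp
    ring
  have eV : ∑ x : (A × B) × J, m x.1 x.2 * k x.1.2 ^ ((β - 1) / β) =
      ∑ b, q b * k b ^ ((β - 1) / β) := by
    rw [Fintype.sum_prod_type, Fintype.sum_prod_type_right]
    simp only [hq, Finset.sum_mul]
  have eU : ∑ x : (A × B) × J, (l x.1.1 * k x.1.2) ^ (-((γ - 1) / γ)) * m x.1 x.2 *
      t x.2 ^ ((γ - 1) / γ) = ∑ j, g j * t j ^ ((γ - 1) / γ) := by
    rw [Fintype.sum_prod_type_right]
    simp only [hg, Finset.sum_mul, ← neg_div, neg_sub]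
  rw [eF, eV, eU, log_rpow hS0, inv_div, inv_div, inv_div] at hH
  have e1 : α / (α - 1) * (α⁻¹ * log S) = (α - 1)⁻¹ * log S := by field_simp
  have e2 : (1 - β)⁻¹ = -(β - 1)⁻¹ := by rw [← neg_sub, inv_neg]
  rw [e1] at hH
  rw [e2, neg_mul]
  linarith

theorem isHermitian_mul_diagonal_mul {n : Type*} [Fintype n] [DecidableEq n]
    (V : Matrix n n ℂ) (d : n → ℝ) : (V * diagonal (fun i => (d i : ℂ)) * Vᴴ).IsHermitian := by
  rw [IsHermitian, conjTranspose_mul, conjTranspose_mul, conjTranspose_conjTranspose,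
    diagonal_conjTranspose, Matrix.mul_assoc]
  congr 3
  ext i
  simp

theorem Matrix.PosSemidef.exists_unitary_diagonal {n : Type*} [Fintype n] [DecidableEq n]
    {M : Matrix n n ℂ} (hM : M.PosSemidef) :
    ∃ (V : Matrix n n ℂ) (d : n → ℝ), Vᴴ * V = 1 ∧ V * Vᴴ = 1 ∧ (∀ i, 0 ≤ d i) ∧
      M = V * diagonal (fun i => (d i : ℂ)) * Vᴴ :=
  ⟨(hM.1.eigenvectorUnitary : Matrix n n ℂ), hM.1.eigenvalues,
    Unitary.coe_star_mul_self hM.1.eigenvectorUnitary,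
    Unitary.coe_mul_star_self hM.1.eigenvectorUnitary, hM.eigenvalues_nonneg,
    hM.1.spectral_theorem⟩

theorem Matrix.PosSemidef.exists_eq_mul_conjTranspose {n : Type*} [Fintype n] [DecidableEq n]
    {M : Matrix n n ℂ} (hM : M.PosSemidef) : ∃ R : Matrix n n ℂ, M = R * Rᴴ := by
  obtain ⟨V, d, -, -, hd, rfl⟩ := hM.exists_unitary_diagonal
  refine ⟨V * diagonal fun i => ((√(d i) : ℝ) : ℂ), ?_⟩
  rw [conjTranspose_mul, diagonal_conjTranspose, ← Matrix.mul_assoc,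
    Matrix.mul_assoc V (diagonal _) (diagonal _), diagonal_mul_diagonal]
  congr 3
  ext i
  simp [← Complex.ofReal_mul, Real.mul_self_sqrt (hd i)]

/-- `matPow` may be computed in any unitary diagonalization. -/
theorem matPow_unitary_conj {n : Type*} [Fintype n] [DecidableEq n] {V : Matrix n n ℂ}
    (hV : Vᴴ * V = 1) (d : n → ℝ) (r : ℝ) :
    matPow (V * diagonal (fun i => (d i : ℂ)) * Vᴴ) r =
      V * diagonal (fun i => (supPow (d i) r : ℂ)) * Vᴴ := by
  have hV' : V * Vᴴ = 1 := mul_eq_one_comm.1 hV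
  set M := V * diagonal (fun i => (d i : ℂ)) * Vᴴ with hMdef
  have hM : M.IsHermitian := isHermitian_mul_diagonal_mul V d
  rw [matPow, dif_pos hM]
  set U : Matrix n n ℂ := hM.eigenvectorUnitary.1
  have hU : star U * U = 1 := Unitary.coe_star_mul_self hM.eigenvectorUnitary
  have hU' : U * star U = 1 := Unitary.coe_mul_star_self hM.eigenvectorUnitary
  have hspec : M = U * diagonal (fun i => (hM.eigenvalues i : ℂ)) * star U := hM.spectral_theorem
  have hcomm : diagonal (fun i => (hM.eigenvalues i : ℂ)) * (star U * V) =
      (star U * V) * diagonal (fun i => (d i : ℂ)) := by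
    have h1 : star U * M * V = diagonal (fun i => (hM.eigenvalues i : ℂ)) * (star U * V) := by
      conv_lhs => rw [hspec]
      simp only [← Matrix.mul_assoc]
      rw [hU, Matrix.one_mul]
    have h2 : star U * M * V = (star U * V) * diagonal (fun i => (d i : ℂ)) := by
      rw [hMdef]
      simp only [Matrix.mul_assoc]
      rw [hV, Matrix.mul_one]
    rw [← h1, h2]
  have hcomm' : diagonal (fun i => (supPow (hM.eigenvalues i) r : ℂ)) * (star U * V) =
      (star U * V) * diagonal (fun i => (supPow (d i) r : ℂ)) := by
    ext i j
    have h := congrFun (congrFun hcomm i) j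
    rw [diagonal_mul, mul_diagonal] at h ⊢
    rcases eq_or_ne ((star U * V) i j) 0 with h0 | h0
    · rw [h0, mul_zero, zero_mul]
    · rw [mul_comm] at h
      have : hM.eigenvalues i = d j := by exact_mod_cast mul_left_cancel₀ h0 h
      rw [this, mul_comm]
  calc U * diagonal (fun i => (supPow (hM.eigenvalues i) r : ℂ)) * star U
      = U * (diagonal (fun i => (supPow (hM.eigenvalues i) r : ℂ)) * (star U * V)) * Vᴴ := by
        simp only [Matrix.mul_assoc]; rw [hV', Matrix.mul_one]
    _ = V * diagonal (fun i => (supPow (d i) r : ℂ)) * Vᴴ := by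
        rw [hcomm']; simp only [← Matrix.mul_assoc]; rw [hU', Matrix.one_mul]

theorem trace_unitary_conj {n : Type*} [Fintype n] [DecidableEq n] {V : Matrix n n ℂ}
    (hV : Vᴴ * V = 1) (M : Matrix n n ℂ) : (V * M * Vᴴ).trace = M.trace := by
  rw [Matrix.trace_mul_comm, ← Matrix.mul_assoc, hV, Matrix.one_mul]

theorem trace_matPow_eq_sum_roots {n : Type*} [Fintype n] [DecidableEq n] {M : Matrix n n ℂ}
    (hM : M.IsHermitian) (r : ℝ) :
    (matPow M r).trace = (M.charpoly.roots.map fun z => (supPow z.re r : ℂ)).sum := by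
  rw [hM.roots_charpoly_eq_eigenvalues, matPow, dif_pos hM]
  have h := trace_unitary_conj (V := (hM.eigenvectorUnitary : Matrix n n ℂ))
    (Unitary.coe_star_mul_self hM.eigenvectorUnitary)
    (diagonal fun i => (supPow (hM.eigenvalues i) r : ℂ))
  rw [← star_eq_conjTranspose] at h
  rw [h, trace_diagonal, Multiset.map_map]
  rfl

theorem trace_matPow_mul_conjTranspose {n : Type*} [Fintype n] [DecidableEq n]
    (X : Matrix n n ℂ) (r : ℝ) :
    (matPow (X * Xᴴ) r).trace = (matPow (Xᴴ * X) r).trace := by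
  rw [trace_matPow_eq_sum_roots (isHermitian_mul_conjTranspose_self X),
    trace_matPow_eq_sum_roots (isHermitian_conjTranspose_mul_self X), charpoly_mul_comm]

theorem trace_matPow_unitary_conj {n : Type*} [Fintype n] [DecidableEq n] {V M : Matrix n n ℂ}
    (hV : Vᴴ * V = 1) (hM : M.IsHermitian) (r : ℝ) :
    (matPow (V * M * Vᴴ) r).trace = (matPow M r).trace := by
  rw [trace_matPow_eq_sum_roots hM,
    trace_matPow_eq_sum_roots (isHermitian_mul_mul_conjTranspose V hM), charpoly_mul_comm,
    ← Matrix.mul_assoc, hV, Matrix.one_mul]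

theorem supPow_of_ne_zero {r : ℝ} (hr : r ≠ 0) (x : ℝ) : supPow x r = x ^ r := by
  unfold supPow
  split_ifs with h
  · rw [h, Real.zero_rpow hr]
  · rfl

theorem conjTranspose_mul_diagonal_mul_apply_self {n : Type*} [Fintype n] [DecidableEq n]
    (X : Matrix n n ℂ) (w : n → ℝ) (j : n) :
    (Xᴴ * diagonal (fun i => (w i : ℂ)) * X) j j =
      ((∑ i, w i * Complex.normSq (X i j) : ℝ) : ℂ) := by
  rw [Matrix.mul_apply]
  push_cast
  refine Finset.sum_congr rfl fun i _ => ?_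
  rw [mul_diagonal, conjTranspose_apply, Complex.normSq_eq_conj_mul_self]
  simp only [RCLike.star_def]
  ring

/-- The trace functional in the sandwiched divergence, for a second argument diagonalized by `V`
and a first argument factored as `(V * X) * (V * X)ᴴ`. -/
theorem trace_matPow_sandwich {n : Type*} [Fintype n] [DecidableEq n] {V X : Matrix n n ℂ}
    (hV : Vᴴ * V = 1) {d : n → ℝ} (hd : ∀ i, 0 ≤ d i) {α : ℝ} (hα : 0 < α) (hα1 : α ≠ 1) :
    (matPow (matPow (V * diagonal (fun i => (d i : ℂ)) * Vᴴ) ((1 - α) / (2 * α)) *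
        (V * (X * Xᴴ) * Vᴴ) *
        matPow (V * diagonal (fun i => (d i : ℂ)) * Vᴴ) ((1 - α) / (2 * α))) α).trace =
      (matPow (Xᴴ * diagonal (fun i => ((d i ^ ((1 - α) / α) : ℝ) : ℂ)) * X) α).trace := by
  have hs : (1 - α) / (2 * α) ≠ 0 :=
    div_ne_zero (sub_ne_zero.2 hα1.symm) (by positivity)
  rw [matPow_unitary_conj hV]
  simp only [supPow_of_ne_zero hs]
  set E : Matrix n n ℂ := diagonal fun i => ((d i ^ ((1 - α) / (2 * α)) : ℝ) : ℂ) with hE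
  have hEh : Eᴴ = E := by
    rw [hE, diagonal_conjTranspose]; congr 1; ext i; simp
  have hEE : E * E = diagonal (fun i => ((d i ^ ((1 - α) / α) : ℝ) : ℂ)) := by
    rw [hE, diagonal_mul_diagonal]
    congr 1
    ext i
    rw [← Complex.ofReal_mul, ← sq, ← Real.rpow_mul_natCast (hd i)]
    have : (1 - α) / (2 * α) * (2 : ℕ) = (1 - α) / α := by push_cast; field_simp
    rw [this]
  have h1 : V * E * Vᴴ * (V * (X * Xᴴ) * Vᴴ) * (V * E * Vᴴ) = (V * E * X) * (V * E * X)ᴴ := by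
    rw [conjTranspose_mul, conjTranspose_mul, hEh]
    calc V * E * Vᴴ * (V * (X * Xᴴ) * Vᴴ) * (V * E * Vᴴ)
        = V * E * (Vᴴ * V) * (X * Xᴴ) * (Vᴴ * V) * E * Vᴴ := by simp only [Matrix.mul_assoc]
      _ = _ := by rw [hV]; simp only [Matrix.mul_assoc, Matrix.one_mul]
  have h2 : (V * E * X)ᴴ * (V * E * X) =
      Xᴴ * diagonal (fun i => ((d i ^ ((1 - α) / α) : ℝ) : ℂ)) * X := by
    rw [conjTranspose_mul, conjTranspose_mul, hEh, ← hEE]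
    calc Xᴴ * (E * Vᴴ) * (V * E * X) = Xᴴ * E * (Vᴴ * V) * E * X := by
          simp only [Matrix.mul_assoc]
      _ = _ := by rw [hV]; simp only [Matrix.mul_assoc, Matrix.one_mul]
  rw [h1, trace_matPow_mul_conjTranspose, h2]

theorem trace_mul_diagonalized {n : Type*} [Fintype n] [DecidableEq n] {V X : Matrix n n ℂ}
    (hV : Vᴴ * V = 1) (d : n → ℝ) :
    ((V * (X * Xᴴ) * Vᴴ) * (V * diagonal (fun i => (d i : ℂ)) * Vᴴ)).trace =
      ((∑ j, ∑ i, d i * Complex.normSq (X i j) : ℝ) : ℂ) := by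
  have h : (V * (X * Xᴴ) * Vᴴ) * (V * diagonal (fun i => (d i : ℂ)) * Vᴴ) =
      V * ((X * Xᴴ) * diagonal (fun i => (d i : ℂ))) * Vᴴ := by
    calc _ = V * (X * Xᴴ) * (Vᴴ * V) * diagonal (fun i => (d i : ℂ)) * Vᴴ := by
          simp only [Matrix.mul_assoc]
      _ = _ := by rw [hV]; simp only [Matrix.mul_assoc, Matrix.one_mul]
  rw [h, trace_unitary_conj hV, Matrix.mul_assoc, Matrix.trace_mul_comm, Matrix.trace]
  push_cast
  refine Finset.sum_congr rfl fun j _ => ?_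
  rw [diag_apply, conjTranspose_mul_diagonal_mul_apply_self]
  push_cast
  rfl

open Real in
/-- Peierls' inequality, in logarithmic form: the diagonal of a positive semidefinite matrix. -/
theorem log_sum_diag_rpow_le {n : Type*} [Fintype n] [DecidableEq n] {Z : Matrix n n ℂ}
    (hZ : Z.PosSemidef) {g : n → ℝ} (hg : ∀ j, Z j j = (g j : ℂ)) {j₀ : n} (hg₀ : 0 < g j₀)
    {p : ℝ} (hp : 0 < p) (hp1 : p ≠ 1) :
    (p - 1)⁻¹ * log (∑ j, g j ^ p) ≤ (p - 1)⁻¹ * log (matPow Z p).trace.re := by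
  obtain ⟨V, d, hV, hV', hd, rfl⟩ := hZ.exists_unitary_diagonal
  rw [matPow_unitary_conj hV, trace_unitary_conj hV, trace_diagonal]
  simp only [supPow_of_ne_zero hp.ne', ← Complex.ofReal_sum, Complex.ofReal_re]
  have hgd : ∀ j, g j = ∑ i, Complex.normSq (V j i) * d i := fun j => by
    have h := conjTranspose_mul_diagonal_mul_apply_self Vᴴ d j
    rw [conjTranspose_conjTranspose, hg] at h
    rw [Complex.ofReal_inj.1 h]
    refine Finset.sum_congr rfl fun i _ => ?_
    rw [conjTranspose_apply, mul_comm]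
    simp
  have hrow : ∀ j, ∑ i, Complex.normSq (V j i) = 1 := fun j => by
    have h := conjTranspose_mul_diagonal_mul_apply_self Vᴴ (fun _ => 1) j
    rw [conjTranspose_conjTranspose] at h
    simp only [Complex.ofReal_one, diagonal_one, Matrix.mul_one, hV', one_apply_eq, one_mul,
      conjTranspose_apply, RCLike.star_def, Complex.normSq_conj] at h
    exact_mod_cast h.symm
  have hcol : ∀ i, ∑ j, Complex.normSq (V j i) = 1 := fun i => by
    have h := conjTranspose_mul_diagonal_mul_apply_self V (fun _ => 1) i
    simp only [Complex.ofReal_one, diagonal_one, Matrix.mul_one, hV, one_apply_eq, one_mul] at h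
    exact_mod_cast h.symm
  have hg0 : ∀ j, 0 ≤ g j := fun j => by
    rw [hgd]
    exact Finset.sum_nonneg fun i _ => mul_nonneg (Complex.normSq_nonneg _) (hd i)
  have hpos : 0 < ∑ j, g j ^ p :=
    sum_pos_of_pos (fun j => rpow_nonneg (hg0 j) p) (rpow_pos_of_pos hg₀ p)
  have hswap : ∑ j, ∑ i, Complex.normSq (V j i) * d i ^ p = ∑ i, d i ^ p := by
    rw [Finset.sum_comm]
    simp [← Finset.sum_mul, hcol]
  rcases hp1.lt_or_gt with h1 | h1
  · have hd₀ : ∃ i, 0 < d i := by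
      by_contra! h
      have : ∀ i, d i = 0 := fun i => le_antisymm (h i) (hd i)
      simp [hgd, this] at hg₀
    obtain ⟨i, hi⟩ := hd₀
    refine mul_le_mul_of_nonpos_left (log_le_log (sum_pos_of_pos
      (fun i => rpow_nonneg (hd i) p) (rpow_pos_of_pos hi p)) ?_) (inv_nonpos.2 (by linarith))
    rw [← hswap]
    refine Finset.sum_le_sum fun j _ => ?_
    rw [hgd]
    simpa using (concaveOn_rpow hp.le h1.le).le_map_sum
      (fun i _ => Complex.normSq_nonneg (V j i)) (hrow j) (fun i _ => hd i)
  · refine mul_le_mul_of_nonneg_left (log_le_log hpos ?_) (inv_nonneg.2 (by linarith))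
    rw [← hswap]
    refine Finset.sum_le_sum fun j _ => ?_
    rw [hgd]
    simpa using (convexOn_rpow h1.le).map_sum_le
      (fun i _ => Complex.normSq_nonneg (V j i)) (hrow j) (fun i _ => hd i)

theorem Matrix.induction_on_kronecker {A B : Type*} [Finite A] [Finite B] [DecidableEq A]
    [DecidableEq B] {P : Matrix (A × B) (A × B) ℂ → Prop} (h0 : P 0)
    (hadd : ∀ M N, P M → P N → P (M + N)) (hmul : ∀ M N, P (M ⊗ₖ N))
    (M : Matrix (A × B) (A × B) ℂ) : P M := by
  refine Matrix.induction_on' M h0 hadd fun i j x => ?_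
  have h := hmul (single i.1 j.1 x) (single i.2 j.2 1)
  rwa [single_kronecker_single, mul_one] at h

theorem margFst_add {A B : Type*} [Fintype B] (M N : Matrix (A × B) (A × B) ℂ) :
    margFst (M + N) = margFst M + margFst N := by
  ext; simp [margFst, Finset.sum_add_distrib]

theorem margSnd_add {A B : Type*} [Fintype A] (M N : Matrix (A × B) (A × B) ℂ) :
    margSnd (M + N) = margSnd M + margSnd N := by
  ext; simp [margSnd, Finset.sum_add_distrib]

theorem margFst_kronecker {A B : Type*} [Fintype B] (M : Matrix A A ℂ) (N : Matrix B B ℂ) :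
    margFst (M ⊗ₖ N) = N.trace • M := by
  ext
  simp [margFst, Matrix.trace, ← Finset.mul_sum, mul_comm]

theorem margSnd_kronecker {A B : Type*} [Fintype A] (M : Matrix A A ℂ) (N : Matrix B B ℂ) :
    margSnd (M ⊗ₖ N) = M.trace • N := by
  ext
  simp [margSnd, Matrix.trace, ← Finset.sum_mul]

theorem margFst_conj {A B : Type*} [Fintype A] [Fintype B] [DecidableEq A] [DecidableEq B]
    (U : Matrix A A ℂ) {W : Matrix B B ℂ}
    (hW : Wᴴ * W = 1) (M : Matrix (A × B) (A × B) ℂ) :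
    margFst ((U ⊗ₖ W) * M * (U ⊗ₖ W)ᴴ) = U * margFst M * Uᴴ := by
  induction M using Matrix.induction_on_kronecker with
  | h0 => simp [show margFst (0 : Matrix (A × B) (A × B) ℂ) = 0 by ext; simp [margFst]]
  | hadd M N hM hN =>
    rw [Matrix.mul_add, Matrix.add_mul, margFst_add, margFst_add, hM, hN, Matrix.mul_add,
      Matrix.add_mul]
  | hmul M N =>
    rw [conjTranspose_kronecker, ← mul_kronecker_mul, ← mul_kronecker_mul, margFst_kronecker,
      margFst_kronecker, trace_unitary_conj hW]
    simp

theorem margSnd_conj {A B : Type*} [Fintype A] [Fintype B] [DecidableEq A] [DecidableEq B]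
    {U : Matrix A A ℂ} (hU : Uᴴ * U = 1)
    (W : Matrix B B ℂ) (M : Matrix (A × B) (A × B) ℂ) :
    margSnd ((U ⊗ₖ W) * M * (U ⊗ₖ W)ᴴ) = W * margSnd M * Wᴴ := by
  induction M using Matrix.induction_on_kronecker with
  | h0 => simp [show margSnd (0 : Matrix (A × B) (A × B) ℂ) = 0 by ext; simp [margSnd]]
  | hadd M N hM hN =>
    rw [Matrix.mul_add, Matrix.add_mul, margSnd_add, margSnd_add, hM, hN, Matrix.mul_add,
      Matrix.add_mul]
  | hmul M N =>
    rw [conjTranspose_kronecker, ← mul_kronecker_mul, ← mul_kronecker_mul, margSnd_kronecker,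
      margSnd_kronecker, trace_unitary_conj hU]
    simp

/-- The first marginal as a sum of compressions. -/
theorem margFst_eq_sum_submatrix {A B : Type*} [Fintype B] (M : Matrix (A × B) (A × B) ℂ) :
    margFst M = ∑ b, M.submatrix (fun a => (a, b)) (fun a => (a, b)) := by
  ext; simp [margFst, Matrix.sum_apply]

/-- The second marginal as a sum of compressions. -/
theorem margSnd_eq_sum_submatrix {A B : Type*} [Fintype A] (M : Matrix (A × B) (A × B) ℂ) :
    margSnd M = ∑ a, M.submatrix (fun b => (a, b)) (fun b => (a, b)) := by
  ext; simp [margSnd, Matrix.sum_apply]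

theorem posSemidef_margFst {A B : Type*} [Fintype A] [Fintype B] {M : Matrix (A × B) (A × B) ℂ}
    (hM : M.PosSemidef) :
    (margFst M).PosSemidef := by
  rw [margFst_eq_sum_submatrix]
  exact posSemidef_sum _ fun b _ => hM.submatrix _

theorem posSemidef_margSnd {A B : Type*} [Fintype A] [Fintype B] {M : Matrix (A × B) (A × B) ℂ}
    (hM : M.PosSemidef) :
    (margSnd M).PosSemidef := by
  rw [margSnd_eq_sum_submatrix]
  exact posSemidef_sum _ fun b _ => hM.submatrix _

/-- The factorization of a bipartite state relative to product eigenbases. -/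
theorem exists_factor_diagonal {A B : Type*} [Fintype A] [Fintype B] [DecidableEq A]
    [DecidableEq B] {ρ : Matrix (A × B) (A × B) ℂ} (hρ : ρ.PosSemidef)
    {V : Matrix (A × B) (A × B) ℂ} (hV : V * Vᴴ = 1) {w : A × B → ℝ} (hw : ∀ i, 0 ≤ w i) :
    ∃ (X : Matrix (A × B) (A × B) ℂ) (z : A × B → ℝ), ρ = V * (X * Xᴴ) * Vᴴ ∧
      Xᴴ * diagonal (fun i => (w i : ℂ)) * X = diagonal fun i => (z i : ℂ) := by
  obtain ⟨R, rfl⟩ := hρ.exists_eq_mul_conjTranspose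
  have hZ : ((Vᴴ * R)ᴴ * diagonal (fun i => (w i : ℂ)) * (Vᴴ * R)).PosSemidef :=
    (PosSemidef.diagonal fun i => by simpa using hw i).conjTranspose_mul_mul_same _
  obtain ⟨Y, z, hY, hY', -, hYz⟩ := hZ.exists_unitary_diagonal
  refine ⟨Vᴴ * R * Y, z, ?_, ?_⟩
  · rw [conjTranspose_mul (Vᴴ * R), conjTranspose_mul Vᴴ, conjTranspose_conjTranspose]
    calc R * Rᴴ = (V * Vᴴ) * R * Rᴴ * (V * Vᴴ) := by rw [hV]; simp
      _ = (V * Vᴴ) * R * (Y * Yᴴ) * Rᴴ * (V * Vᴴ) := by rw [hY', Matrix.mul_one]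
      _ = _ := by simp only [Matrix.mul_assoc]
  · rw [conjTranspose_mul (Vᴴ * R)]
    calc _ = Yᴴ * ((Vᴴ * R)ᴴ * diagonal (fun i => (w i : ℂ)) * (Vᴴ * R)) * Y := by
          simp only [Matrix.mul_assoc]
      _ = (Yᴴ * Y) * diagonal (fun i => (z i : ℂ)) * (Yᴴ * Y) := by
          rw [hYz]; simp only [Matrix.mul_assoc]
      _ = _ := by rw [hY]; simp

theorem mul_conjTranspose_apply_self {n : Type*} [Fintype n] (X : Matrix n n ℂ) (i : n) :
    (X * Xᴴ) i i = ((∑ j, Complex.normSq (X i j) : ℝ) : ℂ) := by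
  rw [Matrix.mul_apply]
  push_cast
  exact Finset.sum_congr rfl fun j _ => by
    rw [conjTranspose_apply, RCLike.star_def, Complex.mul_conj]

theorem unitary_conj_injective {n : Type*} [Fintype n] [DecidableEq n] {V M N : Matrix n n ℂ}
    (hV : Vᴴ * V = 1) (h : V * M * Vᴴ = V * N * Vᴴ) : M = N := by
  have e : ∀ P : Matrix n n ℂ, Vᴴ * (V * P * Vᴴ) * V = P := fun P => by
    calc _ = (Vᴴ * V) * P * (Vᴴ * V) := by simp only [Matrix.mul_assoc]
      _ = P := by rw [hV]; simp
  rw [← e M, h, e N]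

/-- The factor of a bipartite state vanishes on the kernel of the first marginal. -/
theorem factor_eq_zero_of_margFst {A B : Type*} [Fintype A] [Fintype B] [DecidableEq A]
    [DecidableEq B] {ρ X : Matrix (A × B) (A × B) ℂ} {U : Matrix A A ℂ} {W : Matrix B B ℂ}
    (hU : Uᴴ * U = 1) (hW : Wᴴ * W = 1) (hX : ρ = (U ⊗ₖ W) * (X * Xᴴ) * (U ⊗ₖ W)ᴴ)
    {l : A → ℝ} (hl : margFst ρ = U * diagonal (fun a => (l a : ℂ)) * Uᴴ)
    (i j : A × B) (hi : l i.1 = 0) : X i j = 0 := by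
  have hfst : margFst (X * Xᴴ) = diagonal fun a => (l a : ℂ) := by
    refine unitary_conj_injective hU ?_
    rw [← hl, ← margFst_conj U hW, ← hX]
  have h := congrFun (congrFun hfst i.1) i.1
  simp only [margFst, of_apply, mul_conjTranspose_apply_self, diagonal_apply_eq] at h
  rw [hi, ← Complex.ofReal_sum, Complex.ofReal_inj] at h
  have h1 := (Finset.sum_eq_zero_iff_of_nonneg fun b _ =>
    Finset.sum_nonneg fun j _ => Complex.normSq_nonneg _).1 h i.2 (Finset.mem_univ _)
  exact Complex.normSq_eq_zero.1 ((Finset.sum_eq_zero_iff_of_nonneg fun j _ =>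
    Complex.normSq_nonneg _).1 h1 j (Finset.mem_univ _))

theorem dominates_margFst_kronecker_one {A B : Type*} [Fintype A] [Fintype B] [DecidableEq A]
    [DecidableEq B] {ρ : Matrix (A × B) (A × B) ℂ} (hρ : ρ.PosSemidef) :
    Dominates (margFst ρ ⊗ₖ (1 : Matrix B B ℂ)) ρ := by
  obtain ⟨U, l, hU, -, -, hUl⟩ := (posSemidef_margFst hρ).exists_unitary_diagonal
  have hV : (U ⊗ₖ (1 : Matrix B B ℂ))ᴴ * (U ⊗ₖ (1 : Matrix B B ℂ)) = 1 := by
    rw [conjTranspose_kronecker, ← mul_kronecker_mul, hU]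
    simp
  obtain ⟨X, -, hX, -⟩ := exists_factor_diagonal hρ (mul_eq_one_comm.1 hV)
    (w := fun _ => 0) (fun _ => le_rfl)
  intro v hv
  set V := U ⊗ₖ (1 : Matrix B B ℂ) with hVdef
  have hL1 : Vᴴ * (margFst ρ ⊗ₖ (1 : Matrix B B ℂ)) =
      diagonal (fun i : A × B => ((l i.1 : ℝ) : ℂ)) * Vᴴ := by
    have h : diagonal (fun i : A × B => ((l i.1 : ℝ) : ℂ)) =
        diagonal (fun a => (l a : ℂ)) ⊗ₖ (1 : Matrix B B ℂ) := by
      rw [← diagonal_one, diagonal_kronecker_diagonal]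
      simp
    rw [h, hVdef, conjTranspose_kronecker, ← mul_kronecker_mul, ← mul_kronecker_mul, hUl,
      ← Matrix.mul_assoc, ← Matrix.mul_assoc, hU]
    simp
  have hu : ∀ i, (l i.1 : ℂ) * (Vᴴ *ᵥ v) i = 0 := fun i => by
    have h := congrArg (Vᴴ *ᵥ ·) hv
    simp only [mulVec_mulVec, hL1, mulVec_zero] at h
    rw [← mulVec_mulVec] at h
    have := congrFun h i
    rwa [mulVec_diagonal] at this
  have hXu : Xᴴ *ᵥ (Vᴴ *ᵥ v) = 0 := by
    ext j
    refine Finset.sum_eq_zero fun i _ => ?_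
    change Xᴴ j i * (Vᴴ *ᵥ v) i = 0
    rcases mul_eq_zero.1 (hu i) with h | h
    · rw [conjTranspose_apply, factor_eq_zero_of_margFst hU (by simp) hX hUl i j
        (by exact_mod_cast h), star_zero, zero_mul]
    · rw [h, mul_zero]
  rw [hX, ← mulVec_mulVec, ← mulVec_mulVec, ← mulVec_mulVec, hXu, mulVec_zero, mulVec_zero]

theorem trace_mul_margFst_kronecker_one {A B : Type*} [Fintype A] [Fintype B] [DecidableEq B]
    (ρ : Matrix (A × B) (A × B) ℂ) :
    (ρ * (margFst ρ ⊗ₖ (1 : Matrix B B ℂ))).trace = (margFst ρ * margFst ρ).trace := by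
  simp only [Matrix.trace, diag_apply, Matrix.mul_apply, Fintype.sum_prod_type, kroneckerMap_apply,
    one_apply, mul_ite, mul_one, mul_zero, Finset.sum_ite_eq', Finset.mem_univ, if_true]
  refine Finset.sum_congr rfl fun a _ => ?_
  rw [Finset.sum_comm]
  refine Finset.sum_congr rfl fun a' _ => ?_
  rw [← Finset.sum_mul]
  rfl

/-- The reference operator of `condEntDown` is never orthogonal to the state. -/
theorem trace_mul_margFst_kronecker_one_ne_zero {A B : Type*} [Fintype A] [Fintype B]
    [DecidableEq B] {ρ : Matrix (A × B) (A × B) ℂ} (hρ : IsDensity ρ) :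
    (ρ * (margFst ρ ⊗ₖ (1 : Matrix B B ℂ))).trace ≠ 0 := by
  rw [trace_mul_margFst_kronecker_one]
  intro h
  have hherm := (posSemidef_margFst hρ.1).1
  have h0 : margFst ρ = 0 := by
    rw [← trace_conjTranspose_mul_self_eq_zero_iff, hherm.eq, h]
  have h1 := hρ.2
  rw [Matrix.trace, Fintype.sum_prod_type] at h1
  have h2 : (margFst ρ).trace = 1 := h1
  rw [h0, trace_zero] at h2
  exact zero_ne_one h2

/-- The decomposition inequality for a fixed `σ_B`, with the trace functionals written out. -/
theorem log_trace_decomposition {A B : Type*} [Fintype A] [Fintype B] [DecidableEq A]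
    [DecidableEq B] {ρ : Matrix (A × B) (A × B) ℂ} (hρ : ρ.PosSemidef) {K : Matrix B B ℂ}
    (hK : IsDensity K) {α β γ : ℝ} (hα : 0 < α) (hβ : 0 < β) (hγ : 0 < γ)
    (hα1 : α ≠ 1) (hβ1 : β ≠ 1) (hγ1 : γ ≠ 1)
    (hrel : α / (α - 1) = β / (β - 1) + γ / (γ - 1))
    (hsign : 0 < (α - 1) * (β - 1) * (γ - 1))
    (htr : (ρ * (margFst ρ ⊗ₖ K)).trace ≠ 0)
    (hdom : Dominates (margFst ρ ⊗ₖ K) ρ ∨ γ < 1) :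
    (α - 1)⁻¹ * Real.log (matPow (matPow (margFst ρ ⊗ₖ (1 : Matrix B B ℂ)) ((1 - α) / (2 * α)) *
        ρ * matPow (margFst ρ ⊗ₖ (1 : Matrix B B ℂ)) ((1 - α) / (2 * α))) α).trace.re +
      (1 - β)⁻¹ * Real.log (matPow (margSnd ρ) β).trace.re ≤
    (γ - 1)⁻¹ * Real.log (matPow (matPow (margFst ρ ⊗ₖ K) ((1 - γ) / (2 * γ)) *
        ρ * matPow (margFst ρ ⊗ₖ K) ((1 - γ) / (2 * γ))) γ).trace.re := by
  obtain ⟨U, l, hU, -, hl, hUl⟩ := (posSemidef_margFst hρ).exists_unitary_diagonal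
  obtain ⟨W, k, hW, hW', hk, hWk⟩ := hK.1.exists_unitary_diagonal
  have hk1 : ∑ b, k b = 1 := by
    have h := hK.2
    rw [hWk, trace_unitary_conj hW, trace_diagonal] at h
    exact_mod_cast h
  have hV : (U ⊗ₖ W)ᴴ * (U ⊗ₖ W) = 1 := by
    rw [conjTranspose_kronecker, ← mul_kronecker_mul, hU, hW, one_kronecker_one]
  have hV' : (U ⊗ₖ W) * (U ⊗ₖ W)ᴴ = 1 := mul_eq_one_comm.1 hV
  have hLK : margFst ρ ⊗ₖ K = (U ⊗ₖ W) *
      diagonal (fun i : A × B => ((l i.1 * k i.2 : ℝ) : ℂ)) * (U ⊗ₖ W)ᴴ := by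
    rw [hUl, hWk, mul_kronecker_mul, mul_kronecker_mul, conjTranspose_kronecker,
      diagonal_kronecker_diagonal]
    simp
  have hL1 : margFst ρ ⊗ₖ (1 : Matrix B B ℂ) = (U ⊗ₖ W) *
      diagonal (fun i : A × B => ((l i.1 : ℝ) : ℂ)) * (U ⊗ₖ W)ᴴ := by
    have h1 : (1 : Matrix B B ℂ) = W * diagonal (fun _ => 1) * Wᴴ := by simp [hW']
    rw [hUl, h1, mul_kronecker_mul, mul_kronecker_mul, conjTranspose_kronecker,
      diagonal_kronecker_diagonal]
    simp
  obtain ⟨X, z, hX, hXz⟩ := exists_factor_diagonal hρ hV'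
    (w := fun i => l i.1 ^ ((1 - α) / α)) (fun i => Real.rpow_nonneg (hl _) _)
  set V := U ⊗ₖ W with hVdef
  have hm : ∀ i j, 0 ≤ Complex.normSq (X i j) := fun i j => Complex.normSq_nonneg _
  have hsnd : ∀ b, margSnd (X * Xᴴ) b b =
      ((∑ a, ∑ j, Complex.normSq (X (a, b) j) : ℝ) : ℂ) := fun b => by
    simp only [margSnd, of_apply, mul_conjTranspose_apply_self]
    push_cast
    rfl
  have hml : ∀ (i : A × B) j, l i.1 = 0 → Complex.normSq (X i j) = 0 := fun i j h => by
    rw [factor_eq_zero_of_margFst hU hW hX hUl i j h, map_zero]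
  have hmk : 1 < γ → ∀ (i : A × B) j, k i.2 = 0 → Complex.normSq (X i j) = 0 := by
    intro h1 i j hi
    have hd := hdom.resolve_right (not_lt.2 h1.le) (V *ᵥ Pi.single i 1) (by
      rw [hLK, mulVec_mulVec, Matrix.mul_assoc, Matrix.mul_assoc, hV, Matrix.mul_one,
        ← mulVec_mulVec, diagonal_mulVec_single]
      simp [hi])
    rw [hX, mulVec_mulVec, Matrix.mul_assoc, Matrix.mul_assoc, hV, Matrix.mul_one,
      ← mulVec_mulVec] at hd
    have h2 : (X * Xᴴ) *ᵥ Pi.single i 1 = 0 := by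
      have := congrArg (Vᴴ *ᵥ ·) hd
      simpa [mulVec_mulVec, hV, ← Matrix.mul_assoc] using this
    have h3 := congrFun h2 i
    rw [mulVec_single_one, col_apply, mul_conjTranspose_apply_self, Pi.zero_apply] at h3
    rw [Complex.ofReal_eq_zero] at h3
    exact (Finset.sum_eq_zero_iff_of_nonneg fun _ _ => hm _ _).1 h3 j (Finset.mem_univ _)
  obtain ⟨i₀, j₀, hm₀, hl₀, hk₀⟩ : ∃ (i : A × B) (j : A × B),
      0 < Complex.normSq (X i j) ∧ 0 < l i.1 ∧ 0 < k i.2 := by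
    have htr' : ((V * (X * Xᴴ) * Vᴴ) * (V *
        diagonal (fun i : A × B => ((l i.1 * k i.2 : ℝ) : ℂ)) * Vᴴ)).trace ≠ 0 := by
      rwa [← hX, ← hLK]
    rw [trace_mul_diagonalized hV, Complex.ofReal_ne_zero] at htr'
    obtain ⟨j, -, hj⟩ := Finset.exists_ne_zero_of_sum_ne_zero htr'
    obtain ⟨i, -, hi⟩ := Finset.exists_ne_zero_of_sum_ne_zero hj
    exact ⟨i, j, (hm i j).lt_of_ne' (right_ne_zero_of_mul hi),
      (hl _).lt_of_ne' (left_ne_zero_of_mul (left_ne_zero_of_mul hi)),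
      (hk _).lt_of_ne' (right_ne_zero_of_mul (left_ne_zero_of_mul hi))⟩
  have hZ := conjTranspose_mul_diagonal_mul_apply_self X
  have hcl := classical_renyi_decomposition hα hβ hγ hα1 hβ1 hγ1 hrel hsign hm hl hk hk1 hml hmk
    hm₀ hk₀
  have hQα : (matPow (matPow (margFst ρ ⊗ₖ (1 : Matrix B B ℂ)) ((1 - α) / (2 * α)) *
      ρ * matPow (margFst ρ ⊗ₖ (1 : Matrix B B ℂ)) ((1 - α) / (2 * α))) α).trace.re =
      ∑ j, (∑ i : A × B, l i.1 ^ ((1 - α) / α) * Complex.normSq (X i j)) ^ α := by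
    have h := trace_matPow_sandwich (X := X) hV (d := fun i : A × B => l i.1) (fun i => hl _)
      hα hα1
    rw [← hL1, ← hX] at h
    rw [h, hXz]
    have h2 := matPow_unitary_conj (V := (1 : Matrix (A × B) (A × B) ℂ)) (by simp) z α
    simp only [conjTranspose_one, Matrix.mul_one, Matrix.one_mul] at h2
    rw [h2, trace_diagonal]
    simp only [supPow_of_ne_zero hα.ne', ← Complex.ofReal_sum, Complex.ofReal_re]
    refine Finset.sum_congr rfl fun j _ => ?_
    have h3 := hZ (fun i => l i.1 ^ ((1 - α) / α)) j
    rw [hXz, diagonal_apply_eq, Complex.ofReal_inj] at h3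
    rw [h3]
  have hPβ := log_sum_diag_rpow_le
    (posSemidef_margSnd (posSemidef_self_mul_conjTranspose X)) hsnd (j₀ := i₀.2)
    (sum_pos_of_pos (fun a => Finset.sum_nonneg fun j _ => hm _ _)
      (i := i₀.1) (sum_pos_of_pos (fun j => hm _ j) hm₀)) hβ hβ1
  rw [← trace_matPow_unitary_conj hW (posSemidef_margSnd (posSemidef_self_mul_conjTranspose X)).1,
    ← margSnd_conj hU, ← hVdef, ← hX] at hPβ
  have hPγ := log_sum_diag_rpow_le ((PosSemidef.diagonal (d := fun i : A × B =>
      (((l i.1 * k i.2) ^ ((1 - γ) / γ) : ℝ) : ℂ)) (fun i => by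
        simpa using Real.rpow_nonneg (mul_nonneg (hl _) (hk _)) _)).conjTranspose_mul_mul_same X)
    (hZ _) (j₀ := j₀) (sum_pos_of_pos (fun i => mul_nonneg
      (Real.rpow_nonneg (mul_nonneg (hl _) (hk _)) _) (hm _ _)) (i := i₀) (by positivity)) hγ hγ1
  have hQγ := trace_matPow_sandwich (X := X) hV (d := fun i : A × B => l i.1 * k i.2)
    (fun i => mul_nonneg (hl _) (hk _)) hγ hγ1
  rw [← hLK, ← hX] at hQγ
  rw [← hQγ] at hPγ
  rw [hQα]
  have e2 : (1 - β)⁻¹ = -(β - 1)⁻¹ := by rw [← neg_sub, inv_neg]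
  rw [e2] at hcl ⊢
  linarith

/-- **Decomposition rule (Theorem 1, Eq. (8)):** for `α > 0`, `β, γ ≥ 1/2` with
`α/(α−1) = β/(β−1) + γ/(γ−1)` and `(α−1)(β−1)(γ−1) > 0`, we have
`I↑_γ(A;B)_ρ ≥ H_β(B)_ρ − H↓_α(B|A)_ρ`. -/
theorem renyi_decomposition_up_ge
    {A B : Type*} [Fintype A] [Fintype B] [DecidableEq A] [DecidableEq B]
    (ρ : Matrix (A × B) (A × B) ℂ) (hρ : IsDensity ρ)
    {α β γ : ℝ} (hα : 0 < α) (hβ : 1 / 2 ≤ β) (hγ : 1 / 2 ≤ γ)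
    (hα1 : α ≠ 1) (hβ1 : β ≠ 1) (hγ1 : γ ≠ 1)
    (hrel : α / (α - 1) = β / (β - 1) + γ / (γ - 1))
    (hsign : 0 < (α - 1) * (β - 1) * (γ - 1)) :
    mutInfUp γ ρ ≥ (renyiEntropy β (margSnd ρ) : EReal) - condEntDown α ρ := by
  refine le_iInf fun ⟨K, hK⟩ => ?_
  by_cases hcond : (ρ * (margFst ρ ⊗ₖ K)).trace ≠ 0 ∧ (Dominates (margFst ρ ⊗ₖ K) ρ ∨ γ < 1)
  · rw [condEntDown, sub_eq_add_neg, neg_neg, renyiDiv, renyiDiv, if_pos hcond,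
      if_pos ⟨trace_mul_margFst_kronecker_one_ne_zero hρ,
        Or.inl (dominates_margFst_kronecker_one hρ.1)⟩, renyiEntropy, ← EReal.coe_add,
      EReal.coe_le_coe_iff]
    have h := log_trace_decomposition hρ.1 hK hα (by linarith) (by linarith) hα1 hβ1 hγ1 hrel
      hsign hcond.1 hcond.2
    have h' := div_le_div_of_nonneg_right h (Real.log_pos one_lt_two).le
    simp only [Real.logb, ← mul_div_assoc]
    rw [← add_div, add_comm]
    exact h'
  · rw [renyiDiv, if_neg hcond]
    exact le_top
end

section
/- Let ρ_AB be a density operator on H_A ⊗ H_B. Let α > 0 and β, γ ≥ 1/2 with α, β, γ ≠ 1 satisfy α/(α−1) = β/(β−1) + γ/(γ−1) and (α−1)(β−1)(γ−1) < 0. Then I↑_γ(A;B)_ρ ≤ H_β(B)_ρ − H↓_α(B|A)_ρ. -/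
open scoped Kronecker ComplexOrder Classical
open Matrix

open scoped Matrix.Norms.L2Operator in
/-- Contractions of `Matrix n n ℂ`, in the operator norm. -/
def IsContr {n : Type*} [Fintype n] [DecidableEq n] (C : Matrix n n ℂ) : Prop := ‖C‖ ≤ 1

section Contraction

open scoped Matrix.Norms.L2Operator

variable {n : Type*} [Fintype n] [DecidableEq n]

lemma IsContr.mul {C D : Matrix n n ℂ} (hC : IsContr C) (hD : IsContr D) : IsContr (C * D) :=
  (norm_mul_le C D).trans (mul_le_one₀ hC (norm_nonneg _) hD)

lemma IsContr.conjTranspose {C : Matrix n n ℂ} (hC : IsContr C) : IsContr Cᴴ := by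
  unfold IsContr
  rwa [l2_opNorm_conjTranspose]

lemma isContr_diagonal {d : n → ℂ} (hd : ∀ i, ‖d i‖ ≤ 1) : IsContr (diagonal d) := by
  unfold IsContr
  rw [l2_opNorm_diagonal]
  exact (pi_norm_le_iff_of_nonneg zero_le_one).mpr hd

lemma isContr_of_conjTranspose_mul_self {C : Matrix n n ℂ} (hC : IsContr (Cᴴ * C)) :
    IsContr C := by
  unfold IsContr at *
  rw [l2_opNorm_conjTranspose_mul_self] at hC
  nlinarith [norm_nonneg C]

lemma isContr_of_mem_unitary {U : Matrix n n ℂ} (hU : Uᴴ * U = 1) : IsContr U := by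
  apply isContr_of_conjTranspose_mul_self
  rw [hU, ← diagonal_one]
  exact isContr_diagonal fun i => by simp

lemma IsContr.sum_col_le {C : Matrix n n ℂ} (hC : IsContr C) (j : n) :
    ∑ i, ‖C i j‖ ^ 2 ≤ 1 := by
  have h := l2_opNorm_mulVec C (WithLp.toLp 2 (Pi.single j (1 : ℂ)))
  have h2 : ‖(EuclideanSpace.equiv n ℂ).symm (C *ᵥ (Pi.single j (1 : ℂ)))‖ ≤ 1 := by
    refine h.trans ?_
    simpa [IsContr] using hC
  have h3 := pow_le_one₀ (n := 2) (norm_nonneg _) h2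
  rw [EuclideanSpace.norm_sq_eq] at h3
  simpa using h3

lemma IsContr.sum_row_le {C : Matrix n n ℂ} (hC : IsContr C) (i : n) :
    ∑ j, ‖C i j‖ ^ 2 ≤ 1 := by
  simpa using hC.conjTranspose.sum_col_le i

end Contraction

section Holder

variable {n : Type*} [Fintype n]

/-- Hölder's inequality for a doubly substochastic weight. -/
lemma sum_substochastic_rpow_mul_rpow_le {P : n → n → ℝ} (hP : ∀ i j, 0 ≤ P i j)
    (hrow : ∀ i, ∑ j, P i j ≤ 1) (hcol : ∀ j, ∑ i, P i j ≤ 1)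
    {k m : n → ℝ} (hk : ∀ i, 0 ≤ k i) (hm : ∀ i, 0 ≤ m i)
    (hK : 0 < ∑ i, k i) (hM : 0 < ∑ i, m i) {s t : ℝ} (hs : 0 ≤ s) (ht : 0 ≤ t)
    (hst : s + t = 1) :
    ∑ i, ∑ j, P i j * (k i ^ s * m j ^ t) ≤ (∑ i, k i) ^ s * (∑ i, m i) ^ t := by
  set K := ∑ i, k i with hKdef
  set M := ∑ i, m i with hMdef
  have hKM : 0 < K ^ s * M ^ t := by positivity
  have key : ∀ i j, k i ^ s * m j ^ t ≤ (K ^ s * M ^ t) * (s * (k i / K) + t * (m j / M)) := by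
    intro i j
    have h := Real.geom_mean_le_arith_mean2_weighted hs ht (div_nonneg (hk i) hK.le)
      (div_nonneg (hm j) hM.le) hst
    rw [Real.div_rpow (hk i) hK.le, Real.div_rpow (hm j) hM.le, div_mul_div_comm,
      div_le_iff₀ hKM] at h
    linarith
  have h1 : ∑ i, ∑ j, P i j * k i ≤ K := by
    refine Finset.sum_le_sum fun i _ => ?_
    rw [← Finset.sum_mul]
    exact mul_le_of_le_one_left (hk i) (hrow i)
  have h2 : ∑ i, ∑ j, P i j * m j ≤ M := by
    rw [Finset.sum_comm]
    refine Finset.sum_le_sum fun i _ => ?_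
    rw [← Finset.sum_mul]
    exact mul_le_of_le_one_left (hm i) (hcol i)
  calc ∑ i, ∑ j, P i j * (k i ^ s * m j ^ t)
      ≤ ∑ i, ∑ j, P i j * ((K ^ s * M ^ t) * (s * (k i / K) + t * (m j / M))) := by
        exact Finset.sum_le_sum fun i _ => Finset.sum_le_sum fun j _ =>
          mul_le_mul_of_nonneg_left (key i j) (hP i j)
    _ = (K ^ s * M ^ t) * (s * ((∑ i, ∑ j, P i j * k i) / K)
          + t * ((∑ i, ∑ j, P i j * m j) / M)) := by
        simp only [Finset.sum_div, Finset.mul_sum, ← Finset.sum_add_distrib]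
        refine Finset.sum_congr rfl fun i _ => Finset.sum_congr rfl fun j _ => ?_
        ring
    _ ≤ (K ^ s * M ^ t) * (s * 1 + t * 1) := by
        gcongr
        · exact (div_le_one hK).2 h1
        · exact (div_le_one hM).2 h2
    _ = K ^ s * M ^ t := by rw [mul_one, mul_one, hst, mul_one]

lemma norm_trace_diagonal_contr_le [DecidableEq n] {C D : Matrix n n ℂ}
    (hC : IsContr C) (hD : IsContr D)
    {ξ : n → ℂ} {y k m : n → ℝ} (hk : ∀ i, 0 ≤ k i) (hm : ∀ i, 0 ≤ m i)
    (hK : 0 < ∑ i, k i) (hM : 0 < ∑ i, m i) {s t : ℝ} (hs : 0 ≤ s) (ht : 0 ≤ t)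
    (hst : s + t = 1) (hξ : ∀ i, ‖ξ i‖ ≤ k i ^ s) (hy : ∀ i, |y i| ≤ m i ^ t) :
    ‖(diagonal ξ * C * diagonal (fun i => (y i : ℂ)) * D).trace‖
      ≤ (∑ i, k i) ^ s * (∑ i, m i) ^ t := by
  have hexp : (diagonal ξ * C * diagonal (fun i => (y i : ℂ)) * D).trace
      = ∑ i, ∑ j, ξ i * C i j * y j * D j i := by
    simp only [trace, diag_apply]
    refine Finset.sum_congr rfl fun i _ => ?_
    rw [mul_apply]
    refine Finset.sum_congr rfl fun j _ => ?_
    rw [mul_diagonal, diagonal_mul]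
  rw [hexp]
  refine le_trans ?_ (sum_substochastic_rpow_mul_rpow_le
    (P := fun i j => (‖C i j‖ ^ 2 + ‖D j i‖ ^ 2) / 2) (fun i j => by positivity) ?_ ?_
    hk hm hK hM hs ht hst)
  · refine (norm_sum_le _ _).trans (Finset.sum_le_sum fun i _ => (norm_sum_le _ _).trans
      (Finset.sum_le_sum fun j _ => ?_))
    have h1 : ‖ξ i * C i j * y j * D j i‖ = (‖C i j‖ * ‖D j i‖) * (‖ξ i‖ * |y j|) := by
      simp only [norm_mul, Complex.norm_real, Real.norm_eq_abs]
      ring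
    rw [h1]
    have h2 := Real.rpow_nonneg (hk i) s
    gcongr
    · nlinarith [sq_nonneg (‖C i j‖ - ‖D j i‖)]
    · exact hξ i
    · exact hy j
  · intro i
    rw [← Finset.sum_div, Finset.sum_add_distrib]
    have := hC.sum_row_le i
    have := hD.sum_col_le i
    linarith
  · intro j
    rw [← Finset.sum_div, Finset.sum_add_distrib]
    have := hC.sum_col_le j
    have := hD.sum_row_le j
    linarith

end Holder

section Spectral

variable {n : Type*} [Fintype n] [DecidableEq n]

lemma supPow_nonneg {x : ℝ} (hx : 0 ≤ x) (r : ℝ) : 0 ≤ supPow x r := by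
  unfold supPow
  split_ifs
  · exact le_rfl
  · exact Real.rpow_nonneg hx r

/-- `matPow` may be computed in any orthonormal eigenbasis. -/
lemma matPow_conj_diagonal {U : Matrix n n ℂ} (hU : Uᴴ * U = 1) (d : n → ℝ) (r : ℝ) :
    matPow (U * diagonal (fun i => (d i : ℂ)) * Uᴴ) r
      = U * diagonal (fun i => (supPow (d i) r : ℂ)) * Uᴴ := by
  have hM : (U * diagonal (fun i => (d i : ℂ)) * Uᴴ).IsHermitian := by
    apply isHermitian_mul_mul_conjTranspose
    rw [IsHermitian, diagonal_conjTranspose]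
    congr 1
    ext i
    simp
  have hU' : U * Uᴴ = 1 := mul_eq_one_comm.mp hU
  rw [matPow, dif_pos hM]
  set V : Matrix n n ℂ := (hM.eigenvectorUnitary : Matrix n n ℂ) with hV
  have hVV : Vᴴ * V = 1 := by
    rw [← star_eq_conjTranspose]; exact Unitary.coe_star_mul_self _
  have hVV' : V * Vᴴ = 1 := mul_eq_one_comm.mp hVV
  have hspec : U * diagonal (fun i => (d i : ℂ)) * Uᴴ
      = V * diagonal (fun i => (hM.eigenvalues i : ℂ)) * Vᴴ := by
    conv_lhs => rw [hM.spectral_theorem]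
    rfl
  set e := hM.eigenvalues
  clear_value e V
  rw [star_eq_conjTranspose]
  have hcomm : diagonal (fun i => (e i : ℂ)) * (Vᴴ * U)
      = (Vᴴ * U) * diagonal (fun i => (d i : ℂ)) := by
    calc _ = Vᴴ * V * diagonal (fun i => (e i : ℂ)) * Vᴴ * U := by
          rw [hVV]; simp only [Matrix.one_mul, Matrix.mul_assoc]
      _ = Vᴴ * (V * diagonal (fun i => (e i : ℂ)) * Vᴴ) * U := by
          simp only [Matrix.mul_assoc]
      _ = Vᴴ * (U * diagonal (fun i => (d i : ℂ)) * Uᴴ) * U := by rw [hspec]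
      _ = Vᴴ * U * diagonal (fun i => (d i : ℂ)) * (Uᴴ * U) := by
          simp only [Matrix.mul_assoc]
      _ = _ := by rw [hU, Matrix.mul_one]
  have hcomm' : diagonal (fun i => (supPow (e i) r : ℂ)) * (Vᴴ * U)
      = (Vᴴ * U) * diagonal (fun i => (supPow (d i) r : ℂ)) := by
    ext i j
    have h := congrFun (congrFun hcomm i) j
    rw [diagonal_mul, mul_diagonal] at h ⊢
    by_cases h0 : (Vᴴ * U) i j = 0
    · simp [h0]
    · have : e i = d j := by
        have := mul_right_cancel₀ h0 (h.trans (mul_comm _ _))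
        exact_mod_cast this
      rw [this, mul_comm]
  calc V * diagonal (fun i => (supPow (e i) r : ℂ)) * Vᴴ
      = V * (diagonal (fun i => (supPow (e i) r : ℂ)) * (Vᴴ * U)) * Uᴴ := by
        simp only [Matrix.mul_assoc, hU', Matrix.mul_one]
    _ = (V * Vᴴ) * U * diagonal (fun i => (supPow (d i) r : ℂ)) * Uᴴ := by
        rw [hcomm']; simp only [Matrix.mul_assoc]
    _ = _ := by rw [hVV', Matrix.one_mul]

lemma trace_conj_diagonal {U : Matrix n n ℂ} (hU : Uᴴ * U = 1) (d : n → ℂ) :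
    (U * diagonal d * Uᴴ).trace = ∑ i, d i := by
  rw [trace_mul_comm, ← Matrix.mul_assoc, hU, Matrix.one_mul, trace_diagonal]

/-- The sum of the `2r`-th powers of the nonzero singular values of `Y`. -/
noncomputable def singPow (Y : Matrix n n ℂ) (r : ℝ) : ℝ := (matPow (Yᴴ * Y) r).trace.re

/-- A singular value decomposition `Y = W y Vᴴ` in which `W` is a partial isometry. -/
lemma exists_singular_value_decomposition (Y : Matrix n n ℂ) :
    ∃ (W V : Matrix n n ℂ) (y : n → ℝ), (∀ i, 0 ≤ y i) ∧ Vᴴ * V = 1 ∧ IsContr W ∧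
      Y = W * diagonal (fun i => (y i : ℂ)) * Vᴴ ∧
      Wᴴ * Y = diagonal (fun i => (y i : ℂ)) * Vᴴ ∧
      (∀ r, 0 < r → singPow Y r = ∑ i, y i ^ (2 * r)) := by
  have hpsd := posSemidef_conjTranspose_mul_self Y
  set V : Matrix n n ℂ := (hpsd.1.eigenvectorUnitary : Matrix n n ℂ) with hV
  have hVV : Vᴴ * V = 1 := by
    rw [← star_eq_conjTranspose]; exact Unitary.coe_star_mul_self _
  have hVV' : V * Vᴴ = 1 := mul_eq_one_comm.mp hVV
  set e := hpsd.1.eigenvalues with he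
  have hspec : Yᴴ * Y = V * diagonal (fun i => (e i : ℂ)) * Vᴴ := by
    conv_lhs => rw [hpsd.1.spectral_theorem]
    rfl
  have he0 : ∀ i, 0 ≤ e i := hpsd.eigenvalues_nonneg
  clear_value V e
  set y : n → ℝ := fun i => √(e i)
  have hye : ∀ i, y i * y i = e i := fun i => Real.mul_self_sqrt (he0 i)
  have hy0 : ∀ i, 0 ≤ y i := fun i => Real.sqrt_nonneg _
  clear_value y
  have hgram : (Y * V)ᴴ * (Y * V) = diagonal (fun i => (e i : ℂ)) := by
    rw [conjTranspose_mul, Matrix.mul_assoc, ← Matrix.mul_assoc Yᴴ, hspec,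
      Matrix.mul_assoc, hVV, Matrix.mul_one, ← Matrix.mul_assoc, hVV,
      Matrix.one_mul]
  have hcol : ∀ i j, y j = 0 → (Y * V) i j = 0 := by
    intro i j hj
    have h := congrFun (congrFun hgram j) j
    have hej : e j = 0 := by rw [← hye, hj, mul_zero]
    simp only [mul_apply (M := (Y * V)ᴴ), conjTranspose_apply, diagonal_apply_eq, hej,
      Complex.ofReal_zero] at h
    have h' : ∑ i, ‖(Y * V) i j‖ ^ 2 = 0 := by
      have h2 : ((∑ i, ‖(Y * V) i j‖ ^ 2 : ℝ) : ℂ) = 0 := by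
        rw [← h]
        push_cast
        exact Finset.sum_congr rfl fun i _ => (Complex.conj_mul' _).symm
      exact_mod_cast h2
    have h3 := (Finset.sum_eq_zero_iff_of_nonneg (fun i _ => by positivity)).1 h' i
      (Finset.mem_univ i)
    simpa using h3
  have hsa : (diagonal (fun i => ((y i)⁻¹ : ℂ)))ᴴ = diagonal (fun i => ((y i)⁻¹ : ℂ)) := by
    rw [diagonal_conjTranspose]
    congr 1
    ext i
    simp
  refine ⟨Y * V * diagonal (fun i => ((y i)⁻¹ : ℂ)), V, y, hy0, hVV, ?_, ?_, ?_, ?_⟩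
  · apply isContr_of_conjTranspose_mul_self
    rw [conjTranspose_mul, hsa, Matrix.mul_assoc, ← Matrix.mul_assoc _ (Y * V), hgram,
      diagonal_mul_diagonal, diagonal_mul_diagonal]
    refine isContr_diagonal fun i => ?_
    rw [← hye]
    by_cases h0 : y i = 0
    · simp [h0]
    · have : (y i : ℂ) ≠ 0 := by exact_mod_cast h0
      push_cast
      field_simp
      simp
  · have : Y * V * diagonal (fun i => ((y i)⁻¹ : ℂ)) * diagonal (fun i => (y i : ℂ)) = Y * V := by
      rw [Matrix.mul_assoc, diagonal_mul_diagonal]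
      ext i j
      rw [mul_diagonal]
      by_cases h0 : y j = 0
      · rw [hcol i j h0, zero_mul]
      · have : (y j : ℂ) ≠ 0 := by exact_mod_cast h0
        field_simp
    rw [this, Matrix.mul_assoc, hVV', Matrix.mul_one]
  · have (Z : Matrix n n ℂ) : Z * Y = Z * (Y * V) * Vᴴ := by
      simp only [Matrix.mul_assoc, hVV', Matrix.mul_one]
    rw [this, conjTranspose_mul, hsa, Matrix.mul_assoc _ _ (Y * V), hgram, diagonal_mul_diagonal]
    congr 2
    ext i
    rw [← hye]
    by_cases h0 : y i = 0
    · simp [h0]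
    · have : (y i : ℂ) ≠ 0 := by exact_mod_cast h0
      push_cast
      field_simp
  · intro r hr
    rw [singPow, hspec, matPow_conj_diagonal hVV, trace_conj_diagonal hVV, Complex.re_sum]
    refine Finset.sum_congr rfl fun i _ => ?_
    rw [Complex.ofReal_re, ← hye, supPow]
    split_ifs with h0
    · rw [mul_self_eq_zero.1 h0, Real.zero_rpow (by positivity)]
    · rw [Real.rpow_mul (hy0 i), Real.rpow_two, sq]

end Spectral

section Interpolation

variable {n : Type*} [Fintype n] [DecidableEq n]

lemma singPow_pos {Y : Matrix n n ℂ} (hY : Y ≠ 0) {r : ℝ} (hr : 0 < r) : 0 < singPow Y r := by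
  obtain ⟨W, V, y, hy0, -, -, hYW, -, hS⟩ := exists_singular_value_decomposition Y
  rw [hS r hr]
  have hnn : ∀ i ∈ Finset.univ, 0 ≤ y i ^ (2 * r) := fun i _ => Real.rpow_nonneg (hy0 i) _
  refine lt_of_le_of_ne (Finset.sum_nonneg hnn) fun h => hY ?_
  have h0 : ∀ i, y i = 0 := fun i => by
    have := (Finset.sum_eq_zero_iff_of_nonneg hnn).1 h.symm i (Finset.mem_univ i)
    exact ((Real.rpow_eq_zero_iff_of_nonneg (hy0 i)).1 this).1
  rw [hYW]
  simp [h0]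

/-- `N` with its columns scaled by `exp (u + v x)`. -/
noncomputable def expScale (N : Matrix n n ℂ) (u v : n → ℝ) (x : ℝ) : Matrix n n ℂ :=
  N * diagonal (fun i => (Real.exp (u i + v i * x) : ℂ))

lemma expScale_ne_zero {N : Matrix n n ℂ} (hN : N ≠ 0) (u v : n → ℝ) (x : ℝ) :
    expScale N u v x ≠ 0 := by
  intro h
  apply hN
  ext i j
  have := congrFun (congrFun h i) j
  rw [expScale, mul_diagonal] at this
  have h1 : (Real.exp (u j + v j * x) : ℂ) ≠ 0 := by exact_mod_cast Real.exp_ne_zero _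
  simpa [h1] using this

/-- Hölder's inequality on a vertical line, for the analytic family in the three lines theorem. -/
lemma norm_trace_family_le {N : Matrix n n ℂ} (hN : N ≠ 0) (u v : n → ℝ)
    {W V : Matrix n n ℂ} (hW : IsContr W) (hV : IsContr V) {k : n → ℝ} (hk : ∀ i, 0 ≤ k i)
    (hK : 0 < ∑ i, k i) {z : ℂ} (hz : z.re ∈ Set.Ico (-1 : ℝ) 1) {ξ : n → ℂ}
    (hξ : ∀ i, ‖ξ i‖ ≤ k i ^ ((1 + z.re) / 2)) :
    ‖(diagonal ξ * (Wᴴ * N * diagonal (fun i => Complex.exp (u i + v i * z)) * V)).trace‖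
      ≤ (∑ i, k i) ^ ((1 + z.re) / 2) *
        singPow (expScale N u v z.re) (1 / (1 - z.re)) ^ ((1 - z.re) / 2) := by
  obtain ⟨hz1, hz2⟩ := hz
  have h1z : 0 < 1 - z.re := by linarith
  have hr : 0 < 1 / (1 - z.re) := by positivity
  obtain ⟨W₀, V₀, y, hy0, hV₀, hW₀, hYW, -, hS⟩ :=
    exists_singular_value_decomposition (expScale N u v z.re)
  have hpos := singPow_pos (expScale_ne_zero hN u v z.re) hr
  rw [hS _ hr] at hpos ⊢
  set E : Matrix n n ℂ := diagonal (fun i => Complex.exp (v i * z.im * Complex.I)) with hE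
  have hEc : IsContr E := isContr_diagonal fun i => by
    rw [← Complex.ofReal_mul, Complex.norm_exp_ofReal_mul_I]
  have hsplit : N * diagonal (fun i => Complex.exp (u i + v i * z))
      = expScale N u v z.re * E := by
    rw [expScale, hE, Matrix.mul_assoc, diagonal_mul_diagonal]
    congr 2
    ext i
    rw [Complex.ofReal_exp, ← Complex.exp_add]
    congr 1
    conv_lhs => rw [← Complex.re_add_im z]
    push_cast
    ring
  have heq : diagonal ξ * (Wᴴ * N * diagonal (fun i => Complex.exp (u i + v i * z)) * V)
      = diagonal ξ * (Wᴴ * W₀) * diagonal (fun i => (y i : ℂ)) * (V₀ᴴ * E * V) := by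
    rw [Matrix.mul_assoc Wᴴ, hsplit, hYW]
    simp only [Matrix.mul_assoc]
  rw [heq]
  refine norm_trace_diagonal_contr_le (hW.conjTranspose.mul hW₀)
    (((isContr_of_mem_unitary hV₀).conjTranspose.mul hEc).mul hV) hk
    (fun i => Real.rpow_nonneg (hy0 i) _) hK hpos (by linarith) (by linarith) (by ring) hξ ?_
  intro i
  rw [← Real.rpow_mul (hy0 i), abs_of_nonneg (hy0 i)]
  have : 2 * (1 / (1 - z.re)) * ((1 - z.re) / 2) = 1 := by field_simp
  rw [this, Real.rpow_one]

/-- Schatten norm interpolation for a matrix with exponentially scaled columns. -/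
lemma convexOn_log_singPow {N : Matrix n n ℂ} (hN : N ≠ 0) (u v : n → ℝ) :
    ConvexOn ℝ (Set.Ico (-1 : ℝ) 1)
      (fun x => (1 - x) * Real.log (singPow (expScale N u v x) (1 / (1 - x)))) := by
  refine LinearOrder.convexOn_of_lt (convex_Ico _ _) ?_
  intro x₀ hx₀ x₁ hx₁ hlt a b ha hb hab
  simp only [smul_eq_mul]
  set x := a * x₀ + b * x₁ with hx
  have hxb : x = x₀ + b * (x₁ - x₀) := by
    rw [hx, eq_sub_of_add_eq hab]
    ring
  have hx0x : x₀ ≤ x := by nlinarith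
  have hxx1 : x ≤ x₁ := by nlinarith
  have hx1 : 0 < 1 - x := by linarith [hx₁.2]
  have hr : 0 < 1 / (1 - x) := by positivity
  obtain ⟨W, V, τ, hτ0, hV, hW, -, hWY, hS⟩ :=
    exists_singular_value_decomposition (expScale N u v x)
  have hK := singPow_pos (expScale_ne_zero hN u v x) hr
  rw [hS _ hr] at hK ⊢
  set p := 2 * (1 / (1 - x)) with hp
  have hp0 : 0 < p := by positivity
  set K := ∑ i, τ i ^ p with hKdef
  have hk : ∀ i, 0 ≤ τ i ^ p := fun i => Real.rpow_nonneg (hτ0 i) _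
  let ξ : ℂ → n → ℂ := fun z i =>
    if τ i = 0 then 0 else Complex.exp ((Real.log (τ i) * p / 2 : ℝ) * (1 + z))
  let G : ℂ → ℂ := fun z =>
    (diagonal (ξ z) * (Wᴴ * N * diagonal (fun i => Complex.exp (u i + v i * z)) * V)).trace
  have hξ : ∀ z i, ‖ξ z i‖ ≤ (τ i ^ p) ^ ((1 + z.re) / 2) := by
    intro z i
    simp only [ξ]
    split_ifs with h0
    · rw [norm_zero]
      exact Real.rpow_nonneg (hk i) _
    · have hτ : 0 < τ i := lt_of_le_of_ne (hτ0 i) (Ne.symm h0)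
      rw [← Real.rpow_mul (hτ0 i), Real.rpow_def_of_pos hτ, Complex.norm_exp,
        Complex.re_ofReal_mul, Complex.add_re, Complex.one_re]
      apply le_of_eq
      congr 1
      ring
  have hGline : ∀ z : ℂ, z.re ∈ Set.Ico (-1 : ℝ) 1 → ‖G z‖ ≤ K ^ ((1 + z.re) / 2) *
      singPow (expScale N u v z.re) (1 / (1 - z.re)) ^ ((1 - z.re) / 2) := fun z hz =>
    norm_trace_family_le hN u v hW (isContr_of_mem_unitary hV) hk hK hz (hξ z)
  have hGsum : ∀ z, G z = ∑ i, ξ z i * ∑ j, (Wᴴ * N) i j * Complex.exp (u j + v j * z) * V j i := by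
    intro z
    simp only [G, trace, diag_apply, diagonal_mul]
    refine Finset.sum_congr rfl fun i _ => ?_
    rw [mul_apply]
    simp only [mul_diagonal]
  have hξd : ∀ i, Differentiable ℂ (fun z => ξ z i) := by
    intro i
    simp only [ξ]
    split_ifs
    · fun_prop
    · fun_prop
  have hGd : Differentiable ℂ G := by
    rw [show G = _ from funext hGsum]
    fun_prop
  have hGx : G x = (K : ℂ) := by
    have h1 : Wᴴ * N * diagonal (fun i => Complex.exp (u i + v i * (x : ℂ)))
        = diagonal (fun i => (τ i : ℂ)) * Vᴴ := by
      rw [← hWY, expScale, Matrix.mul_assoc]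
      congr 3
      ext i
      push_cast
      rfl
    simp only [G]
    rw [h1, Matrix.mul_assoc, hV, Matrix.mul_one, diagonal_mul_diagonal, trace_diagonal, hKdef]
    push_cast
    refine Finset.sum_congr rfl fun i _ => ?_
    simp only [ξ]
    split_ifs with h0
    · rw [h0, Real.zero_rpow hp0.ne', zero_mul, Complex.ofReal_zero]
    · have hτ : 0 < τ i := lt_of_le_of_ne (hτ0 i) (Ne.symm h0)
      have h2 : Real.log (τ i) * p / 2 * (1 + x) + Real.log (τ i) = Real.log (τ i) * p := by
        rw [hp]; field_simp; ring
      have h3 : τ i ^ p = Real.exp (Real.log (τ i) * p / 2 * (1 + x)) * τ i :=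
        (Real.rpow_def_of_pos hτ p).trans
          (by rw [← congrArg Real.exp h2, Real.exp_add, Real.exp_log hτ])
      rw [h3]
      push_cast
      rfl
  have hB : BddAbove ((norm ∘ G) '' Complex.HadamardThreeLines.verticalClosedStrip x₀ x₁) := by
    let H : ℝ → ℝ := fun t => ∑ i, (if τ i = 0 then 0 else
      Real.exp ((Real.log (τ i) * p / 2) * (1 + t))) *
        ∑ j, ‖(Wᴴ * N) i j‖ * Real.exp (u j + v j * t) * ‖V j i‖
    have hHc : Continuous H := by
      refine continuous_finsetSum _ fun i _ => ?_
      refine Continuous.mul ?_ (by fun_prop)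
      split_ifs <;> fun_prop
    obtain ⟨M, hM⟩ := (isCompact_Icc (a := x₀) (b := x₁)).bddAbove_image hHc.continuousOn
    refine ⟨M, ?_⟩
    rintro _ ⟨z, hz, rfl⟩
    refine le_trans ?_ (hM ⟨z.re, hz, rfl⟩)
    simp only [Function.comp, hGsum, H]
    refine (norm_sum_le _ _).trans (Finset.sum_le_sum fun i _ => ?_)
    rw [norm_mul]
    refine mul_le_mul ?_ ?_ (norm_nonneg _) (by split_ifs <;> positivity)
    · simp only [ξ]
      split_ifs
      · simp
      · rw [Complex.norm_exp, Complex.re_ofReal_mul, Complex.add_re, Complex.one_re]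
    · refine (norm_sum_le _ _).trans (Finset.sum_le_sum fun j _ => ?_)
      rw [norm_mul, norm_mul, Complex.norm_exp, Complex.add_re, Complex.re_ofReal_mul,
        Complex.ofReal_re]
  set S₀ := singPow (expScale N u v x₀) (1 / (1 - x₀)) with hS₀
  set S₁ := singPow (expScale N u v x₁) (1 / (1 - x₁)) with hS₁
  have h1x₀ : 0 < 1 - x₀ := by linarith [hx₀.2]
  have h1x₁ : 0 < 1 - x₁ := by linarith [hx₁.2]
  have hS₀pos : 0 < S₀ := singPow_pos (expScale_ne_zero hN u v x₀) (by positivity)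
  have hS₁pos : 0 < S₁ := singPow_pos (expScale_ne_zero hN u v x₁) (by positivity)
  have hmain := Complex.HadamardThreeLines.norm_le_interp_of_mem_verticalClosedStrip'
    (f := G) (z := (x : ℂ)) (a := K ^ ((1 + x₀) / 2) * S₀ ^ ((1 - x₀) / 2))
    (b := K ^ ((1 + x₁) / 2) * S₁ ^ ((1 - x₁) / 2)) hlt
    (show (x : ℂ).re ∈ Set.Icc x₀ x₁ from ⟨hx0x, hxx1⟩) hGd.diffContOnCl hB
    (fun z hz => by
      have hz' : z.re = x₀ := hz
      simpa only [hz'] using hGline z (hz'.symm ▸ hx₀))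
    (fun z hz => by
      have hz' : z.re = x₁ := hz
      simpa only [hz'] using hGline z (hz'.symm ▸ hx₁))
  have hd : 0 < x₁ - x₀ := by linarith
  have hbb : (x - x₀) / (x₁ - x₀) = b := by
    rw [div_eq_iff hd.ne', hxb, add_sub_cancel_left]
  rw [hGx, Complex.ofReal_re, hbb, Complex.norm_real, Real.norm_of_nonneg hK.le,
    show 1 - b = a by linarith] at hmain
  have hlog := Real.log_le_log hK hmain
  have e1 := Real.rpow_pos_of_pos hK ((1 + x₀) / 2)
  have e2 := Real.rpow_pos_of_pos hK ((1 + x₁) / 2)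
  have e3 := Real.rpow_pos_of_pos hS₀pos ((1 - x₀) / 2)
  have e4 := Real.rpow_pos_of_pos hS₁pos ((1 - x₁) / 2)
  rw [Real.log_mul (Real.rpow_pos_of_pos (mul_pos e1 e3) _).ne'
    (Real.rpow_pos_of_pos (mul_pos e2 e4) _).ne', Real.log_rpow (mul_pos e1 e3),
    Real.log_rpow (mul_pos e2 e4), Real.log_mul e1.ne' e3.ne', Real.log_mul e2.ne' e4.ne',
    Real.log_rpow hK, Real.log_rpow hK, Real.log_rpow hS₀pos, Real.log_rpow hS₁pos] at hlog
  have ha' : a = 1 - b := by linarith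
  rw [hx]
  subst ha'
  linarith

end Interpolation

section Marginals

variable {A B : Type*}

lemma margFst_isHermitian [Fintype B] {ρ : Matrix (A × B) (A × B) ℂ} (hρ : ρ.IsHermitian) :
    (margFst ρ).IsHermitian := by
  ext a a'
  simp only [margFst, conjTranspose_apply, of_apply, star_sum]
  exact Finset.sum_congr rfl fun b _ => hρ.apply _ _

lemma margSnd_isHermitian [Fintype A] {ρ : Matrix (A × B) (A × B) ℂ} (hρ : ρ.IsHermitian) :
    (margSnd ρ).IsHermitian := by
  ext a a'
  simp only [margSnd, conjTranspose_apply, of_apply, star_sum]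
  exact Finset.sum_congr rfl fun b _ => hρ.apply _ _

lemma trace_mul_kronecker_one [Fintype A] [Fintype B] [DecidableEq B]
    (ρ : Matrix (A × B) (A × B) ℂ) (M : Matrix A A ℂ) :
    (ρ * (M ⊗ₖ (1 : Matrix B B ℂ))).trace = (margFst ρ * M).trace := by
  simp only [trace, diag_apply, mul_apply, Fintype.sum_prod_type, kroneckerMap_apply, one_apply,
    mul_ite, mul_one, mul_zero, Finset.sum_ite_eq', Finset.mem_univ, if_true, margFst, of_apply,
    Finset.sum_mul]
  exact Finset.sum_congr rfl fun a _ => Finset.sum_comm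

lemma trace_mul_one_kronecker [Fintype A] [Fintype B] [DecidableEq A]
    (ρ : Matrix (A × B) (A × B) ℂ) (M : Matrix B B ℂ) :
    (ρ * ((1 : Matrix A A ℂ) ⊗ₖ M)).trace = (margSnd ρ * M).trace := by
  simp only [trace, diag_apply, mul_apply, Fintype.sum_prod_type, kroneckerMap_apply, one_apply,
    ite_mul, one_mul, zero_mul, mul_ite, mul_zero, margSnd, of_apply, Finset.sum_mul]
  rw [Finset.sum_comm]
  refine Finset.sum_congr rfl fun b _ => ?_
  rw [Finset.sum_comm (s := Finset.univ (α := B))]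
  refine Finset.sum_congr rfl fun a _ => ?_
  rw [Finset.sum_eq_single a]
  · simp
  · intro a' _ h
    simp [h]
  · simp

end Marginals

section ColumnNorms

variable {n : Type*} [Fintype n]

/-- Squared norm of the `p`-th column of `N`. -/
noncomputable def colSq (N : Matrix n n ℂ) (p : n) : ℝ := ∑ k, ‖N k p‖ ^ 2

lemma colSq_nonneg (N : Matrix n n ℂ) (p : n) : 0 ≤ colSq N p :=
  Finset.sum_nonneg fun _ _ => by positivity

lemma colSq_eq_zero {N : Matrix n n ℂ} {p : n} (h : colSq N p = 0) (k : n) : N k p = 0 := by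
  have := (Finset.sum_eq_zero_iff_of_nonneg (fun k _ => by positivity)).1 h k (Finset.mem_univ k)
  simpa using this

lemma conjTranspose_mul_self_apply_self (N : Matrix n n ℂ) (p : n) :
    (Nᴴ * N) p p = (colSq N p : ℂ) := by
  rw [mul_apply, colSq]
  push_cast
  exact Finset.sum_congr rfl fun k _ => Complex.conj_mul' _

end ColumnNorms

section Conjugation

variable {n : Type*} [Fintype n] [DecidableEq n]

lemma trace_matPow_conj {U M : Matrix n n ℂ} (hU : Uᴴ * U = 1) (hM : M.IsHermitian) (r : ℝ) :
    (matPow (U * M * Uᴴ) r).trace = (matPow M r).trace := by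
  set V : Matrix n n ℂ := (hM.eigenvectorUnitary : Matrix n n ℂ) with hV
  have hVV : Vᴴ * V = 1 := by
    rw [← star_eq_conjTranspose]; exact Unitary.coe_star_mul_self _
  have hspec : M = V * diagonal (fun i => (hM.eigenvalues i : ℂ)) * Vᴴ := by
    conv_lhs => rw [hM.spectral_theorem]
    rfl
  have hUV : (U * V)ᴴ * (U * V) = 1 := by
    rw [conjTranspose_mul, Matrix.mul_assoc, ← Matrix.mul_assoc Uᴴ, hU, Matrix.one_mul, hVV]
  set e := hM.eigenvalues
  clear_value e V
  have h2 : U * M * Uᴴ = U * V * diagonal (fun i => (e i : ℂ)) * (U * V)ᴴ := by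
    rw [hspec, conjTranspose_mul]
    simp only [Matrix.mul_assoc]
  rw [h2, hspec, matPow_conj_diagonal hUV, matPow_conj_diagonal hVV, trace_conj_diagonal hUV,
    trace_conj_diagonal hVV]

lemma matPow_one_of_isHermitian {M : Matrix n n ℂ} (hM : M.IsHermitian) : matPow M 1 = M := by
  rw [matPow, dif_pos hM]
  conv_rhs => rw [hM.spectral_theorem]
  have : ∀ x : ℝ, supPow x 1 = x := fun x => by
    unfold supPow
    split_ifs with h
    · exact h.symm
    · exact Real.rpow_one x
  simp only [this]
  rfl

lemma singPow_expScale_zero (N : Matrix n n ℂ) (u v : n → ℝ) :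
    singPow (expScale N u v 0) 1 = ∑ p, colSq N p * Real.exp (2 * u p) := by
  rw [singPow, matPow_one_of_isHermitian (isHermitian_conjTranspose_mul_self _), trace,
    Complex.re_sum]
  refine Finset.sum_congr rfl fun p _ => ?_
  rw [diag_apply, conjTranspose_mul_self_apply_self, Complex.ofReal_re, colSq, colSq,
    Finset.sum_mul]
  refine Finset.sum_congr rfl fun k _ => ?_
  rw [expScale, mul_diagonal, norm_mul, Complex.norm_real, Real.norm_of_nonneg (Real.exp_pos _).le,
    mul_pow, ← Real.exp_nat_mul]
  congr 2
  push_cast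
  ring

/-- The divergence in an eigenbasis `U` of its second argument. -/
lemma renyiDiv_eq_singPow {U N : Matrix n n ℂ} (hU : Uᴴ * U = 1) (hN : N ≠ 0) {d : n → ℝ}
    (hd : ∀ p, 0 ≤ d p) (hcol : ∀ p, d p = 0 → colSq N p = 0) {γ : ℝ} (u v : n → ℝ) (x : ℝ)
    (hx : ∀ p, d p ≠ 0 → u p + v p * x = Real.log (d p) * ((1 - γ) / (2 * γ))) :
    renyiDiv γ (U * (Nᴴ * N) * Uᴴ) (U * diagonal (fun p => (d p : ℂ)) * Uᴴ)
      = (((γ - 1)⁻¹ * Real.logb 2 (singPow (expScale N u v x) γ) : ℝ) : EReal) := by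
  have htr : (U * (Nᴴ * N) * Uᴴ * (U * diagonal (fun p => (d p : ℂ)) * Uᴴ)).trace ≠ 0 := by
    have h1 : U * (Nᴴ * N) * Uᴴ * (U * diagonal (fun p => (d p : ℂ)) * Uᴴ)
        = U * (Nᴴ * N * diagonal (fun p => (d p : ℂ))) * Uᴴ := by
      calc _ = U * (Nᴴ * N) * (Uᴴ * U) * diagonal (fun p => (d p : ℂ)) * Uᴴ := by
            simp only [Matrix.mul_assoc]
        _ = _ := by rw [hU]; simp only [Matrix.mul_assoc, Matrix.one_mul]
    have h2 : (U * (Nᴴ * N * diagonal (fun p => (d p : ℂ))) * Uᴴ).trace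
        = ((∑ p, colSq N p * d p : ℝ) : ℂ) := by
      rw [trace_mul_comm, ← Matrix.mul_assoc, hU, Matrix.one_mul, trace]
      push_cast
      refine Finset.sum_congr rfl fun p _ => ?_
      rw [diag_apply, mul_diagonal, conjTranspose_mul_self_apply_self]
    rw [h1, h2]
    norm_cast
    intro h
    have hnn : ∀ p ∈ Finset.univ, 0 ≤ colSq N p * d p := fun p _ =>
      mul_nonneg (colSq_nonneg N p) (hd p)
    apply hN
    ext k p
    have h3 := (Finset.sum_eq_zero_iff_of_nonneg hnn).1 h p (Finset.mem_univ p)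
    rcases mul_eq_zero.1 h3 with h4 | h4
    · exact colSq_eq_zero h4 k
    · exact colSq_eq_zero (hcol p h4) k
  have hdom : Dominates (U * diagonal (fun p => (d p : ℂ)) * Uᴴ) (U * (Nᴴ * N) * Uᴴ) := by
    intro w hw
    have h1 : diagonal (fun p => (d p : ℂ)) *ᵥ (Uᴴ *ᵥ w) = 0 := by
      have h2 := congrArg (fun t => Uᴴ *ᵥ t) hw
      simp only [mulVec_mulVec, mulVec_zero] at h2
      rw [mulVec_mulVec, ← h2]
      congr 1
      rw [← Matrix.mul_assoc, ← Matrix.mul_assoc, hU, Matrix.one_mul]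
    have h3 : N *ᵥ (Uᴴ *ᵥ w) = 0 := by
      ext k
      simp only [mulVec, dotProduct, Pi.zero_apply]
      refine Finset.sum_eq_zero fun p _ => ?_
      have h4 := congrFun h1 p
      rw [mulVec_diagonal, Pi.zero_apply, mul_eq_zero] at h4
      rcases h4 with h4 | h4
      · rw [colSq_eq_zero (hcol p (by exact_mod_cast h4)) k, zero_mul]
      · exact mul_eq_zero_of_right _ h4
    rw [← mulVec_mulVec, ← mulVec_mulVec, ← mulVec_mulVec, h3, mulVec_zero, mulVec_zero]
  rw [renyiDiv, if_pos ⟨htr, Or.inl hdom⟩]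
  set s := (1 - γ) / (2 * γ)
  rw [matPow_conj_diagonal hU, singPow]
  set D : Matrix n n ℂ := diagonal (fun p => (supPow (d p) s : ℂ)) with hD
  have hDD : Dᴴ = D := by
    rw [hD, diagonal_conjTranspose]
    congr 1
    ext p
    simp
  have hY : expScale N u v x = N * D := by
    ext k p
    rw [expScale, hD, mul_diagonal, mul_diagonal]
    by_cases h0 : d p = 0
    · rw [colSq_eq_zero (hcol p h0) k, zero_mul, zero_mul]
    · rw [hx p h0, supPow, if_neg h0,
        Real.rpow_def_of_pos (lt_of_le_of_ne (hd p) (Ne.symm h0))]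
  have hconj : U * D * Uᴴ * (U * (Nᴴ * N) * Uᴴ) * (U * D * Uᴴ)
      = U * ((N * D)ᴴ * (N * D)) * Uᴴ := by
    rw [conjTranspose_mul, hDD]
    calc _ = U * D * (Uᴴ * U) * (Nᴴ * N) * (Uᴴ * U) * D * Uᴴ := by
          simp only [Matrix.mul_assoc]
      _ = _ := by rw [hU]; simp only [Matrix.mul_assoc, Matrix.one_mul]
  rw [hconj, hY, trace_matPow_conj hU (isHermitian_conjTranspose_mul_self _)]

end Conjugation

section SimultaneousDiagonalization

variable {A B : Type*} [Fintype A] [Fintype B] [DecidableEq A] [DecidableEq B]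

lemma kronecker_conj_diagonal (U : Matrix A A ℂ) (V : Matrix B B ℂ) (d : A → ℝ) (e : B → ℝ) :
    (U * diagonal (fun i => (d i : ℂ)) * Uᴴ) ⊗ₖ (V * diagonal (fun j => (e j : ℂ)) * Vᴴ)
      = (U ⊗ₖ V) * diagonal (fun p => ((d p.1 * e p.2 : ℝ) : ℂ)) * (U ⊗ₖ V)ᴴ := by
  rw [conjTranspose_kronecker, mul_kronecker_mul, mul_kronecker_mul, diagonal_kronecker_diagonal]
  congr 3
  ext p
  push_cast
  rfl

lemma kronecker_conjTranspose_mul_self {U : Matrix A A ℂ} {V : Matrix B B ℂ} (hU : Uᴴ * U = 1)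
    (hV : Vᴴ * V = 1) : (U ⊗ₖ V)ᴴ * (U ⊗ₖ V) = 1 := by
  rw [conjTranspose_kronecker, ← mul_kronecker_mul, hU, hV, one_kronecker_one]

open scoped MatrixOrder Matrix.Norms.L2Operator in
lemma exists_gram_factor {n : Type*} [Fintype n] [DecidableEq n] {ρ : Matrix n n ℂ}
    (hρ : ρ.PosSemidef) : ∃ R : Matrix n n ℂ, ρ = Rᴴ * R :=
  CStarAlgebra.nonneg_iff_eq_star_mul_self.mp hρ.nonneg

lemma trace_conj_diagonal_mul_conj_diagonal {n : Type*} [Fintype n] [DecidableEq n]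
    {Q : Matrix n n ℂ} (hQ : Qᴴ * Q = 1) (c f : n → ℝ) :
    (Q * diagonal (fun i => (c i : ℂ)) * Qᴴ * (Q * diagonal (fun i => (f i : ℂ)) * Qᴴ)).trace
      = ((∑ i, c i * f i : ℝ) : ℂ) := by
  have h1 : Q * diagonal (fun i => (c i : ℂ)) * Qᴴ * (Q * diagonal (fun i => (f i : ℂ)) * Qᴴ)
      = Q * (diagonal (fun i => (c i : ℂ)) * diagonal (fun i => (f i : ℂ))) * Qᴴ := by
    calc _ = Q * diagonal (fun i => (c i : ℂ)) * (Qᴴ * Q) * diagonal (fun i => (f i : ℂ)) * Qᴴ := by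
          simp only [Matrix.mul_assoc]
      _ = _ := by rw [hQ]; simp only [Matrix.mul_assoc, Matrix.one_mul]
  rw [h1, diagonal_mul_diagonal, trace_conj_diagonal hQ]
  push_cast
  rfl

/-- A Gram factor of `ρ` in the product of the eigenbases of its marginals: the squared column
norms are a joint distribution whose marginals are the spectra `a`, `b` of the marginals of `ρ`. -/
lemma exists_marginal_spectra {ρ : Matrix (A × B) (A × B) ℂ} (hρ : IsDensity ρ) :
    ∃ (U : Matrix A A ℂ) (V : Matrix B B ℂ) (a : A → ℝ) (b : B → ℝ)
      (N : Matrix (A × B) (A × B) ℂ), Uᴴ * U = 1 ∧ Vᴴ * V = 1 ∧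
      margFst ρ = U * diagonal (fun i => (a i : ℂ)) * Uᴴ ∧
      margSnd ρ = V * diagonal (fun j => (b j : ℂ)) * Vᴴ ∧
      ρ = (U ⊗ₖ V) * (Nᴴ * N) * (U ⊗ₖ V)ᴴ ∧ N ≠ 0 ∧
      (∀ f : A → ℝ, ∑ p, colSq N p * f p.1 = ∑ i, a i * f i) ∧
      (∀ f : B → ℝ, ∑ p, colSq N p * f p.2 = ∑ j, b j * f j) := by
  have hA := margFst_isHermitian hρ.1.1
  have hB := margSnd_isHermitian hρ.1.1
  obtain ⟨R, hR⟩ := exists_gram_factor hρ.1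
  set U : Matrix A A ℂ := (hA.eigenvectorUnitary : Matrix A A ℂ)
  set V : Matrix B B ℂ := (hB.eigenvectorUnitary : Matrix B B ℂ)
  have hU : Uᴴ * U = 1 := by
    rw [← star_eq_conjTranspose]; exact Unitary.coe_star_mul_self _
  have hV : Vᴴ * V = 1 := by
    rw [← star_eq_conjTranspose]; exact Unitary.coe_star_mul_self _
  have hAs : margFst ρ = U * diagonal (fun i => (hA.eigenvalues i : ℂ)) * Uᴴ := by
    conv_lhs => rw [hA.spectral_theorem]
    rfl
  have hBs : margSnd ρ = V * diagonal (fun j => (hB.eigenvalues j : ℂ)) * Vᴴ := by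
    conv_lhs => rw [hB.spectral_theorem]
    rfl
  set a := hA.eigenvalues
  set b := hB.eigenvalues
  clear_value a b U V
  have hW := kronecker_conjTranspose_mul_self hU hV
  have hW' := mul_eq_one_comm.mp hW
  have hUU := mul_eq_one_comm.mp hU
  have hVV := mul_eq_one_comm.mp hV
  have hρN : ρ = (U ⊗ₖ V) * ((R * (U ⊗ₖ V))ᴴ * (R * (U ⊗ₖ V))) * (U ⊗ₖ V)ᴴ := by
    rw [conjTranspose_mul]
    calc ρ = ((U ⊗ₖ V) * (U ⊗ₖ V)ᴴ) * (Rᴴ * R) * ((U ⊗ₖ V) * (U ⊗ₖ V)ᴴ) := by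
          rw [hW', hR, Matrix.one_mul, Matrix.mul_one]
      _ = _ := by simp only [Matrix.mul_assoc]
  set N := R * (U ⊗ₖ V)
  have htr : ∀ f : A × B → ℝ, ((∑ p, colSq N p * f p : ℝ) : ℂ)
      = (ρ * ((U ⊗ₖ V) * diagonal (fun p => (f p : ℂ)) * (U ⊗ₖ V)ᴴ)).trace := by
    intro f
    rw [hρN]
    have h1 : (U ⊗ₖ V) * (Nᴴ * N) * (U ⊗ₖ V)ᴴ
        * ((U ⊗ₖ V) * diagonal (fun p => (f p : ℂ)) * (U ⊗ₖ V)ᴴ)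
        = (U ⊗ₖ V) * (Nᴴ * N * diagonal (fun p => (f p : ℂ))) * (U ⊗ₖ V)ᴴ := by
      calc _ = (U ⊗ₖ V) * (Nᴴ * N) * ((U ⊗ₖ V)ᴴ * (U ⊗ₖ V))
            * diagonal (fun p => (f p : ℂ)) * (U ⊗ₖ V)ᴴ := by simp only [Matrix.mul_assoc]
        _ = _ := by rw [hW]; simp only [Matrix.mul_assoc, Matrix.one_mul]
    rw [h1, trace_mul_comm, ← Matrix.mul_assoc, hW, Matrix.one_mul, trace]
    push_cast
    refine Finset.sum_congr rfl fun p _ => ?_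
    rw [diag_apply, mul_diagonal, conjTranspose_mul_self_apply_self]
  refine ⟨U, V, a, b, N, hU, hV, hAs, hBs, hρN, ?_, fun f => ?_, fun f => ?_⟩
  · intro h
    have := hρ.2
    rw [hρN, h] at this
    simp at this
  · have h1 := kronecker_conj_diagonal U V f (fun _ => 1)
    simp only [Complex.ofReal_one, diagonal_one, hVV, mul_one] at h1
    have h2 := htr (fun p => f p.1)
    rw [← h1, trace_mul_kronecker_one, hAs, trace_conj_diagonal_mul_conj_diagonal hU] at h2
    exact_mod_cast h2
  · have h1 := kronecker_conj_diagonal U V (fun _ => 1) f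
    simp only [Complex.ofReal_one, diagonal_one, Matrix.mul_one, hUU, one_mul] at h1
    have h2 := htr (fun p => f p.2)
    rw [← h1, trace_mul_one_kronecker, hBs, trace_conj_diagonal_mul_conj_diagonal hV] at h2
    exact_mod_cast h2

end SimultaneousDiagonalization

/-- Monotonicity of secants through `0` in the form of a three-term harmonic relation. -/
lemma ConvexOn.div_add_div_le {s : Set ℝ} {g : ℝ → ℝ} (hg : ConvexOn ℝ s g) {a b c : ℝ}
    (h0 : 0 ∈ s) (ha : a ∈ s) (hc : c ∈ s) (ha0 : a ≠ 0) (hc0 : c ≠ 0)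
    (hrel : a⁻¹ = b⁻¹ + c⁻¹) (hca : c ≤ a) : g c / c + g 0 / b ≤ g a / a := by
  have h := hg.secant_mono h0 hc ha hc0 ha0 hca
  have hb : b⁻¹ = a⁻¹ - c⁻¹ := by linarith
  simp only [sub_zero, sub_div] at h
  rw [div_eq_mul_inv (g 0) b, hb]
  simp only [div_eq_mul_inv] at h ⊢
  linarith

lemma isDensity_conj_diagonal {n : Type*} [Fintype n] [DecidableEq n] {U : Matrix n n ℂ}
    (hU : Uᴴ * U = 1) {d : n → ℝ} (hd : ∀ i, 0 ≤ d i) (hsum : ∑ i, d i = 1) :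
    IsDensity (U * diagonal (fun i => (d i : ℂ)) * Uᴴ) := by
  refine ⟨(PosSemidef.diagonal fun i => ?_).mul_mul_conjTranspose_same U, ?_⟩
  · show (0 : ℂ) ≤ ((d i : ℝ) : ℂ)
    exact_mod_cast hd i
  · rw [trace_conj_diagonal hU]
    exact_mod_cast hsum

/-- **Decomposition rule (Theorem 1, Eq. (10)):** for `α > 0`, `β, γ ≥ 1/2` with
`α/(α−1) = β/(β−1) + γ/(γ−1)` and `(α−1)(β−1)(γ−1) < 0`, we have
`I↑_γ(A;B)_ρ ≤ H_β(B)_ρ − H↓_α(B|A)_ρ`. -/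
theorem renyi_decomposition_up_le
    {A B : Type*} [Fintype A] [Fintype B] [DecidableEq A] [DecidableEq B]
    (ρ : Matrix (A × B) (A × B) ℂ) (hρ : IsDensity ρ)
    {α β γ : ℝ} (hα : 0 < α) (hβ : 1 / 2 ≤ β) (hγ : 1 / 2 ≤ γ)
    (hα1 : α ≠ 1) (hβ1 : β ≠ 1) (hγ1 : γ ≠ 1)
    (hrel : α / (α - 1) = β / (β - 1) + γ / (γ - 1))
    (hsign : (α - 1) * (β - 1) * (γ - 1) < 0) :
    mutInfUp γ ρ ≤ (renyiEntropy β (margSnd ρ) : EReal) - condEntDown α ρ := by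
  obtain ⟨U, V, a, b, N, hU, hV, hA, hB, hρN, hN, hfst, hsnd⟩ := exists_marginal_spectra hρ
  have hW := kronecker_conjTranspose_mul_self hU hV
  have ha : ∀ i, a i = ∑ p : A × B, colSq N p * if p.1 = i then 1 else 0 := fun i => by
    rw [hfst (fun k => if k = i then 1 else 0)]; simp
  have hb : ∀ j, b j = ∑ p : A × B, colSq N p * if p.2 = j then 1 else 0 := fun j => by
    rw [hsnd (fun k => if k = j then 1 else 0)]; simp
  have hnnA : ∀ i, ∀ p ∈ Finset.univ, 0 ≤ colSq N p * if p.1 = i then 1 else 0 := fun i p _ =>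
    mul_nonneg (colSq_nonneg N p) (by split_ifs <;> norm_num)
  have hnnB : ∀ j, ∀ p ∈ Finset.univ, 0 ≤ colSq N p * if p.2 = j then 1 else 0 := fun j p _ =>
    mul_nonneg (colSq_nonneg N p) (by split_ifs <;> norm_num)
  have ha0 : ∀ i, 0 ≤ a i := fun i => by
    rw [ha]; exact Finset.sum_nonneg (hnnA i)
  have hb0 : ∀ j, 0 ≤ b j := fun j => by
    rw [hb]; exact Finset.sum_nonneg (hnnB j)
  have hcolA : ∀ p : A × B, a p.1 = 0 → colSq N p = 0 := fun p h => by
    rw [ha] at h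
    simpa using (Finset.sum_eq_zero_iff_of_nonneg (hnnA p.1)).1 h p (Finset.mem_univ p)
  have hcolB : ∀ p : A × B, b p.2 = 0 → colSq N p = 0 := fun p h => by
    rw [hb] at h
    simpa using (Finset.sum_eq_zero_iff_of_nonneg (hnnB p.2)).1 h p (Finset.mem_univ p)
  set Z : ℝ := ∑ j, supPow (b j) β with hZ
  have hZpos : 0 < Z := by
    refine lt_of_le_of_ne (Finset.sum_nonneg fun j _ => supPow_nonneg (hb0 j) β) fun h => hN ?_
    have hbz : ∀ j, b j = 0 := fun j => by
      have h1 := (Finset.sum_eq_zero_iff_of_nonneg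
        (fun j _ => supPow_nonneg (hb0 j) β)).1 h.symm j (Finset.mem_univ j)
      by_contra hne
      rw [supPow, if_neg hne] at h1
      exact hne ((Real.rpow_eq_zero_iff_of_nonneg (hb0 j)).1 h1).1
    ext k p
    exact colSq_eq_zero (hcolB p (hbz p.2)) k
  set s : B → ℝ := fun j => supPow (b j) β / Z with hs
  have hs0 : ∀ j, 0 ≤ s j := fun j => div_nonneg (supPow_nonneg (hb0 j) β) hZpos.le
  have hssum : ∑ j, s j = 1 := by
    rw [hs, ← Finset.sum_div, ← hZ, div_self hZpos.ne']
  have hslog : ∀ j, b j ≠ 0 → Real.log (s j) = β * Real.log (b j) - Real.log Z := by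
    intro j hj
    have hbj : 0 < b j := lt_of_le_of_ne (hb0 j) (Ne.symm hj)
    simp only [hs]
    rw [supPow, if_neg hj, Real.log_div (Real.rpow_pos_of_pos hbj β).ne' hZpos.ne',
      Real.log_rpow hbj]
  have hsne : ∀ j, s j = 0 → b j = 0 := by
    intro j hj
    by_contra hne
    have hbj : 0 < b j := lt_of_le_of_ne (hb0 j) (Ne.symm hne)
    simp only [hs] at hj
    rw [supPow, if_neg hne] at hj
    exact (div_pos (Real.rpow_pos_of_pos hbj β) hZpos).ne' hj
  have hβ0 : 0 < β := by linarith
  have hγ0 : 0 < γ := by linarith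
  have hα' := sub_ne_zero.2 hα1
  have hβ' := sub_ne_zero.2 hβ1
  have hγ' := sub_ne_zero.2 hγ1
  obtain ⟨x, hx⟩ : ∃ x, x = (α - 1) / α := ⟨_, rfl⟩
  obtain ⟨y, hy⟩ : ∃ y, y = (β - 1) / β := ⟨_, rfl⟩
  obtain ⟨z, hz⟩ : ∃ z, z = (γ - 1) / γ := ⟨_, rfl⟩
  have hx0 : x ≠ 0 := hx ▸ div_ne_zero hα' hα.ne'
  have hy0 : y ≠ 0 := hy ▸ div_ne_zero hβ' hβ0.ne'
  have hz0 : z ≠ 0 := hz ▸ div_ne_zero hγ' hγ0.ne'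
  have hxyz : x⁻¹ = y⁻¹ + z⁻¹ := by
    rw [hx, hy, hz, inv_div, inv_div, inv_div, hrel]
  have hprod : x * y * z < 0 := by
    have : x * y * z = ((α - 1) * (β - 1) * (γ - 1)) / (α * β * γ) := by
      rw [hx, hy, hz]; field_simp
    rw [this]
    exact div_neg_of_neg_of_pos hsign (by positivity)
  have hrel' : y * z = x * z + x * y := by
    field_simp at hxyz
    linarith
  have hzx : z < x := by
    have h1 : x * y * z = y ^ 2 * (z - x) := by linear_combination y * (-hrel')
    rw [h1] at hprod
    have h2 : 0 < y ^ 2 := by positivity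
    nlinarith
  have hz1 : -1 ≤ z := by
    rw [hz, le_div_iff₀ hγ0]; linarith
  have hx1 : x < 1 := by
    rw [hx, div_lt_one hα]; linarith
  have h1x : 1 / (1 - x) = α := by
    rw [hx]; field_simp; ring
  have h1z : 1 / (1 - z) = γ := by
    rw [hz]; field_simp; ring
  let u : A × B → ℝ := fun p => y / 2 * Real.log (s p.2)
  let v : A × B → ℝ := fun p => -(Real.log (a p.1) + y / x * Real.log (s p.2)) / 2
  have hdivA : renyiDiv α ρ (margFst ρ ⊗ₖ (1 : Matrix B B ℂ))
      = (((α - 1)⁻¹ * Real.logb 2 (singPow (expScale N u v x) α) : ℝ) : EReal) := by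
    have h1 := kronecker_conj_diagonal U V a (fun _ => 1)
    simp only [Complex.ofReal_one, diagonal_one, Matrix.mul_one, mul_eq_one_comm.mp hV] at h1
    rw [hA, h1]
    conv_lhs => rw [hρN]
    refine renyiDiv_eq_singPow hW hN (fun p => by simpa using ha0 p.1)
      (fun p h => hcolA p (by simpa using h)) u v x fun p _ => ?_
    have h2 : (1 - α) / (2 * α) = -x / 2 := by rw [hx]; field_simp; ring
    rw [h2, mul_one]
    simp only [u, v]
    field_simp
    ring
  have hdivC : renyiDiv γ ρ (margFst ρ ⊗ₖ (V * diagonal (fun j => (s j : ℂ)) * Vᴴ))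
      = (((γ - 1)⁻¹ * Real.logb 2 (singPow (expScale N u v z) γ) : ℝ) : EReal) := by
    rw [hA, kronecker_conj_diagonal U V a s]
    conv_lhs => rw [hρN]
    refine renyiDiv_eq_singPow hW hN (fun p => mul_nonneg (ha0 p.1) (hs0 p.2))
      (fun p h => (mul_eq_zero.1 h).elim (hcolA p) fun h => hcolB p (hsne p.2 h)) u v z
      fun p hp => ?_
    have h2 : (1 - γ) / (2 * γ) = -z / 2 := by rw [hz]; field_simp; ring
    rw [h2, Real.log_mul (left_ne_zero_of_mul hp) (right_ne_zero_of_mul hp)]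
    simp only [u, v]
    field_simp
    linear_combination Real.log (s p.2) * (-hrel')
  have hzero : Real.log (singPow (expScale N u v 0) (1 / (1 - 0))) = Real.log Z / β := by
    have h1 : singPow (expScale N u v 0) 1 = Real.exp (-y * Real.log Z) * Z := by
      rw [singPow_expScale_zero, hsnd (fun j => Real.exp (2 * (y / 2 * Real.log (s j)))), hZ,
        Finset.mul_sum]
      refine Finset.sum_congr rfl fun j _ => ?_
      by_cases hj : b j = 0
      · rw [hj, supPow, if_pos rfl, zero_mul, mul_zero]
      · have hbj : 0 < b j := lt_of_le_of_ne (hb0 j) (Ne.symm hj)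
        rw [supPow, if_neg hj, Real.rpow_def_of_pos hbj, ← Real.exp_add, hslog j hj]
        nth_rewrite 1 [← Real.exp_log hbj]
        rw [← Real.exp_add, ← hZ]
        congr 1
        rw [hy]
        field_simp
        ring
    rw [sub_zero, div_one, h1, Real.log_mul (Real.exp_pos _).ne' hZpos.ne', Real.log_exp, hy]
    field_simp
    ring
  have hent : renyiEntropy β (margSnd ρ) = (1 - β)⁻¹ * Real.logb 2 Z := by
    rw [renyiEntropy, hB, matPow_conj_diagonal hV, trace_conj_diagonal hV, Complex.re_sum, hZ]
    simp only [Complex.ofReal_re]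
  have hconv := (convexOn_log_singPow hN u v).div_add_div_le (a := x) (b := y) (c := z)
    ⟨by norm_num, by norm_num⟩ ⟨by linarith, hx1⟩ ⟨hz1, by linarith⟩ hx0 hz0 hxyz hzx.le
  simp only [h1x, h1z, hzero] at hconv
  rw [mutInfUp, condEntDown, hdivA, hent, ← EReal.coe_neg, ← EReal.coe_sub]
  refine iInf_le_of_le ⟨_, isDensity_conj_diagonal hV hs0 hssum⟩ ?_
  rw [hdivC, EReal.coe_le_coe_iff]
  have hx' : (1 - x) / x = (α - 1)⁻¹ := by rw [hx]; field_simp; ring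
  have hz' : (1 - z) / z = (γ - 1)⁻¹ := by rw [hz]; field_simp; ring
  have hy' : 1 / β / y = -(1 - β)⁻¹ := by
    rw [hy, ← neg_sub β 1, inv_neg]; field_simp
  have hfin : (γ - 1)⁻¹ * Real.log (singPow (expScale N u v z) γ)
      ≤ (1 - β)⁻¹ * Real.log Z + (α - 1)⁻¹ * Real.log (singPow (expScale N u v x) α) := by
    rw [← hx', ← hz']
    have e1 : (1 - (0 : ℝ)) * (Real.log Z / β) / y = 1 / β / y * Real.log Z := by ring
    rw [e1, hy'] at hconv
    have e2 : ∀ t l : ℝ, (1 - t) * l / t = (1 - t) / t * l := fun t l => by ring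
    rw [e2, e2] at hconv
    linarith
  have hlog2 : 0 < Real.log 2 := Real.log_pos one_lt_two
  simp only [Real.logb, sub_neg_eq_add, ← mul_div_assoc, ← add_div]
  exact div_le_div_of_nonneg_right hfin hlog2.le
end
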